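/- arXiv:2303.10045 — 4 statements merged into one kernel-verified Lean document; each statement's English description precedes it below -/
import Mathlib

section
/- For every compact set K ⊂ {(x,y) ∈ ℝ² : x²+y² < 1/2} there exist N and ε ∈ (0, π/2) such that for all n > N, all (j,k) ∈ ℤ², and each ordered pair of consecutive directions ((ι₁,ι₁′),(ι₂,ι₂′)) ∈ {((1,0),(0,1)), ((0,1),(−1,0)), ((−1,0),(0,−1)), ((0,−1),(1,0))}: if the three points (j/(n+1), k/(n+1)), ((j+ι₁)/(n+1), (k+ι₁′)/(n+1)) and ((j+ι₂)/(n+1), (k+ι₂′)/(n+1)) all lie in K, then, setting u₁ := T_n(j+ι₁, k+ι₁′) − T_n(j,k) and u₂ := T_n(j+ι₂, k+ι₂′) − T_n(j,k), the principal argument arg(u₂/u₁) lies in the interval (ε, π−ε). -/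
noncomputable section

/-- A function `f : ℤ³ → ℂ` solves the Aztec system with data `(b0, bE, bN, bW, bS)`.
Only the values on `Λ = {(j,k,n) : j+k+n odd}` are relevant/constrained. -/
def SolvesAztec (b0 bE bN bW bS : ℂ) (f : ℤ → ℤ → ℤ → ℂ) : Prop :=
  (∀ j k : ℤ, Odd (j + k) → f j k 0 = 0) ∧
  (∀ j k : ℤ, Even (j + k) → f j k (-1) = 0) ∧
  (∀ j k n : ℤ, Even (j + k + n) →
    f j k (n + 1) + f j k (n - 1)
      - (1/2) * (f (j-1) k n + f (j+1) k n + f j (k+1) n + f j (k-1) n)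
    = (if j = 0 ∧ k = 0 ∧ n = 0 then b0 else 0)
      + (1/2) * ((if j = n ∧ k = 0 then bE else 0)
               + (if j = -n ∧ k = 0 then bW else 0)
               + (if j = 0 ∧ k = n then bN else 0)
               + (if j = 0 ∧ k = -n then bS else 0)))

/-- The t-embedding extended to all parities: `T_n(j,k) := T(j,k,n)` if `j+k+n` is odd,
and `T_n(j,k) := T(j,k,n+1)` if `j+k+n` is even. -/
def Text (T : ℤ → ℤ → ℤ → ℂ) (n j k : ℤ) : ℂ :=
  if Odd (j + k + n) then T j k n else T j k (n + 1)

/-- `kraw u b s` is the coefficient of `X ^ s` in `X (1 + X) ^ u (1 - X) ^ b`, a shifted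
(unnormalised) Krawtchouk polynomial. -/
def kraw (u b s : ℕ) : ℝ :=
  (Polynomial.X * ((1 + Polynomial.X) ^ u * (1 - Polynomial.X) ^ b) : Polynomial ℝ).coeff s

lemma kraw_zero (u b : ℕ) : kraw u b 0 = 0 := by simp [kraw]

lemma kraw_one (u b : ℕ) : kraw u b 1 = 1 := by
  simp [kraw, Polynomial.coeff_zero_eq_eval_zero]

lemma kraw_succ_left (u b s : ℕ) :
    kraw (u + 1) b (s + 1) = kraw u b (s + 1) + kraw u b s := by
  have h : (Polynomial.X * ((1 + Polynomial.X) ^ (u + 1) * (1 - Polynomial.X) ^ b) :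
      Polynomial ℝ) = Polynomial.X * ((1 + Polynomial.X) ^ u * (1 - Polynomial.X) ^ b)
        + Polynomial.X * (Polynomial.X * ((1 + Polynomial.X) ^ u * (1 - Polynomial.X) ^ b)) := by
    ring
  rw [kraw, h, Polynomial.coeff_add, Polynomial.coeff_X_mul (Polynomial.X * _)]
  rfl

lemma kraw_succ_right (u b s : ℕ) :
    kraw u (b + 1) (s + 1) = kraw u b (s + 1) - kraw u b s := by
  have h : (Polynomial.X * ((1 + Polynomial.X) ^ u * (1 - Polynomial.X) ^ (b + 1)) :
      Polynomial ℝ) = Polynomial.X * ((1 + Polynomial.X) ^ u * (1 - Polynomial.X) ^ b)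
        - Polynomial.X * (Polynomial.X * ((1 + Polynomial.X) ^ u * (1 - Polynomial.X) ^ b)) := by
    ring
  rw [kraw, h, Polynomial.coeff_sub, Polynomial.coeff_X_mul (Polynomial.X * _)]
  rfl

lemma kraw_zero_zero (s : ℕ) : kraw 0 0 (s + 2) = 0 := by
  simp [kraw, Polynomial.coeff_X]

/-- Prove a statement about `kraw u b` from the case `u = b = 0` and the two recursions. -/
lemma kraw_induction {P : ℕ → ℕ → Prop} (h0 : P 0 0) (hl : ∀ u b, P u b → P (u + 1) b)
    (hr : ∀ u b, P u b → P u (b + 1)) (u b : ℕ) : P u b := by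
  induction u with
  | zero =>
    induction b with
    | zero => exact h0
    | succ b ih => exact hr _ _ ih
  | succ u ih => exact hl _ _ ih

lemma kraw_eq_zero (u b : ℕ) : ∀ s, kraw u b (u + b + 2 + s) = 0 := by
  induction u, b using kraw_induction with
  | h0 => intro s; rw [show 0 + 0 + 2 + s = s + 2 by ring]; exact kraw_zero_zero s
  | hl u b ih =>
    intro s
    rw [show u + 1 + b + 2 + s = (u + b + 2 + s) + 1 by ring, kraw_succ_left, ih s,
      show u + b + 2 + s + 1 = u + b + 2 + (s + 1) by ring, ih, add_zero]
  | hr u b ih =>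
    intro s
    rw [show u + (b + 1) + 2 + s = (u + b + 2 + s) + 1 by ring, kraw_succ_right, ih s,
      show u + b + 2 + s + 1 = u + b + 2 + (s + 1) by ring, ih, sub_zero]

lemma kraw_top (u b : ℕ) : kraw u b (u + b + 1) = (-1) ^ b := by
  induction u, b using kraw_induction with
  | h0 => simpa using kraw_one 0 0
  | hl u b ih =>
    have h := kraw_eq_zero u b 0
    rw [show u + 1 + b + 1 = (u + b + 1) + 1 by ring, kraw_succ_left, ih]
    simpa using h
  | hr u b ih =>
    have h := kraw_eq_zero u b 0
    rw [show u + (b + 1) + 1 = (u + b + 1) + 1 by ring, kraw_succ_right, ih, pow_succ]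
    simp only [add_zero] at h
    rw [h]
    ring

/-- The three-term recurrence of Krawtchouk polynomials. -/
lemma kraw_recurrence (u b : ℕ) : ∀ s : ℕ, ((s : ℝ) + 1) * kraw u b (s + 2)
    = ((u : ℝ) - b) * kraw u b (s + 1) - ((u : ℝ) + b - s + 1) * kraw u b s := by
  induction u, b using kraw_induction with
  | h0 =>
    rintro (_ | _ | s)
    · simp [kraw_zero_zero, kraw_zero]
    · have h := kraw_zero_zero 1
      have h' := kraw_zero_zero 0
      simp_all
    · have h := kraw_zero_zero s
      have h' := kraw_zero_zero (s + 1)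
      have h'' := kraw_zero_zero (s + 2)
      simp_all
  | hl u b ih =>
    rintro (_ | s)
    · have h := ih 0
      simp only [kraw_succ_left, kraw_zero] at h ⊢
      push_cast at h ⊢
      linear_combination h
    · have h := ih s
      have h' := ih (s + 1)
      simp only [kraw_succ_left] at h h' ⊢
      push_cast at h h' ⊢
      linear_combination h + h'
  | hr u b ih =>
    rintro (_ | s)
    · have h := ih 0
      simp only [kraw_succ_right, kraw_zero] at h ⊢
      push_cast at h ⊢
      linear_combination h
    · have h := ih s
      have h' := ih (s + 1)
      simp only [kraw_succ_right] at h h' ⊢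
      push_cast at h h' ⊢
      linear_combination h' - h

lemma kraw_pair_ne_zero (u b : ℕ) : ∀ s : ℕ, s ≤ u + b →
    ¬ (kraw u b s = 0 ∧ kraw u b (s + 1) = 0) := by
  intro s
  induction s with
  | zero => rintro - ⟨-, h⟩; simp [kraw_one] at h
  | succ s ih =>
    rintro hs ⟨h1, h2⟩
    have h := kraw_recurrence u b s
    rw [h1, h2] at h
    have hs' : (s : ℝ) + 1 ≤ u + b := by exact_mod_cast hs
    refine ih (by omega) ⟨?_, h1⟩
    have : ((u : ℝ) + b - s + 1) * kraw u b s = 0 := by linarith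
    rcases mul_eq_zero.1 this with h3 | h3
    · linarith
    · exact h3

/-- Quantitative Turán inequality for Krawtchouk polynomials in the oscillatory region. -/
lemma kraw_turan {u b s : ℕ} {κ : ℝ} (hs : s ≤ u + b) (hκ : κ < 1)
    (h : ((u : ℝ) - b) ^ 2 + (2 * (s : ℝ) - (u + b)) ^ 2 ≤ κ * ((u : ℝ) + b + 2) ^ 2) :
    0 < kraw u b (s + 1) ^ 2 - kraw u b s * kraw u b (s + 2) ∧
    (1 - κ) / 4 * (kraw u b (s + 1) ^ 2 + kraw u b s ^ 2)
      ≤ kraw u b (s + 1) ^ 2 - kraw u b s * kraw u b (s + 2) ∧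
    (1 - κ) / 4 * (kraw u b (s + 1) ^ 2 + kraw u b (s + 2) ^ 2)
      ≤ kraw u b (s + 1) ^ 2 - kraw u b s * kraw u b (s + 2) := by
  have hrec := kraw_recurrence u b s
  have hne := kraw_pair_ne_zero u b s hs
  generalize kraw u b (s + 1) = x at *
  generalize kraw u b s = y at *
  generalize kraw u b (s + 2) = z at *
  have hs' : (s : ℝ) ≤ u + b := by exact_mod_cast hs
  obtain ⟨P, hP⟩ : ∃ P : ℝ, P = s + 1 := ⟨_, rfl⟩
  obtain ⟨Q, hQ⟩ : ∃ Q : ℝ, Q = u + b - s + 1 := ⟨_, rfl⟩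
  obtain ⟨W, hW⟩ : ∃ W : ℝ, W = u - b := ⟨_, rfl⟩
  have hP0 : 0 < P := by rw [hP]; positivity
  have hQ0 : 0 < Q := by linarith
  have hdisc : (1 - κ) * (P + Q) ^ 2 ≤ 4 * P * Q - W ^ 2 := by
    have e1 : 2 * (s : ℝ) - (u + b) = P - Q := by rw [hP, hQ]; ring
    have e2 : (u : ℝ) + b + 2 = P + Q := by rw [hP, hQ]; ring
    rw [e1, e2, ← hW] at h
    linarith
  rw [← hP, ← hQ, ← hW] at hrec
  have form : ∀ p q t r : ℝ, 0 < p → 0 < q → p + q = P + Q → p * q = P * Q →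
      (1 - κ) / 4 * (P + Q) * (t ^ 2 + r ^ 2) ≤ p * t ^ 2 - W * t * r + q * r ^ 2 := by
    intro p q t r hp hq hpq hpq'
    have key : (1 - κ) / 4 * (P + Q) ^ 2 * (t ^ 2 + r ^ 2)
        ≤ (P + Q) * (p * t ^ 2 - W * t * r + q * r ^ 2) := by
      have h1 : (P + Q) * (p * t ^ 2 - W * t * r + q * r ^ 2)
          - (p * q - W ^ 2 / 4) * (t ^ 2 + r ^ 2)
          = (p * t - W / 2 * r) ^ 2 + (q * r - W / 2 * t) ^ 2 := by
        rw [← hpq]; ring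
      have h2 : (1 - κ) / 4 * (P + Q) ^ 2 ≤ p * q - W ^ 2 / 4 := by rw [hpq']; linarith
      have h3 := mul_le_mul_of_nonneg_right h2 (by positivity : 0 ≤ t ^ 2 + r ^ 2)
      have h4 := sq_nonneg (p * t - W / 2 * r)
      have h5 := sq_nonneg (q * r - W / 2 * t)
      linarith only [h1, h3, h4, h5]
    have hL : 0 < P + Q := by linarith only [hP0, hQ0]
    refine le_of_mul_le_mul_left ?_ hL
    linarith only [key]
  have hxy := form P Q x y hP0 hQ0 rfl rfl
  have hxz := form Q P x z hQ0 hP0 (add_comm _ _) (mul_comm _ _)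
  have e1 : P * (x ^ 2 - y * z) = P * x ^ 2 - W * x * y + Q * y ^ 2 := by
    linear_combination -y * hrec
  have e2 : Q * (x ^ 2 - y * z) = Q * x ^ 2 - W * x * z + P * z ^ 2 := by
    linear_combination -z * hrec
  have hκ' : 0 < (1 - κ) / 4 := by linarith
  have low : ∀ p q r : ℝ, 0 < p → 0 < q → p + q = P + Q →
      (1 - κ) / 4 * (P + Q) * (x ^ 2 + r ^ 2) ≤ p * (x ^ 2 - y * z) →
      (1 - κ) / 4 * (x ^ 2 + r ^ 2) ≤ x ^ 2 - y * z := by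
    intro p q r hp hq hpq hle
    have h0 : 0 ≤ (1 - κ) / 4 * (x ^ 2 + r ^ 2) := by positivity
    have h1 := mul_nonneg hq.le h0
    rw [← hpq] at hle
    refine le_of_mul_le_mul_left ?_ hp
    linarith only [hle, h1]
  have l1 := low P Q y hP0 hQ0 rfl (by rw [e1]; exact hxy)
  have l2 := low Q P z hQ0 hP0 (add_comm _ _) (by rw [e2]; exact hxz)
  refine ⟨?_, l1, l2⟩
  have : 0 < x ^ 2 + y ^ 2 := by
    refine lt_of_le_of_ne (by positivity) fun h0 => hne ?_
    exact ⟨by nlinarith [sq_nonneg x, sq_nonneg y], by nlinarith [sq_nonneg x, sq_nonneg y]⟩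
  have := mul_pos hκ' this
  linarith

/-- The complex face weights whose products are the edges of the t-embedding. -/
def faceWeight (c : ℂ) (m b a : ℕ) : ℂ := kraw (m - b) b (a + 1) + c * kraw (m - b) b a

lemma faceWeight_succ (c : ℂ) {m b : ℕ} (a : ℕ) (hb : b ≤ m) :
    faceWeight c (m + 1) b (a + 1) = faceWeight c m b (a + 1) + faceWeight c m b a := by
  simp only [faceWeight, Nat.succ_sub hb, Nat.succ_eq_add_one, kraw_succ_left]
  push_cast
  ring

lemma faceWeight_succ_succ (c : ℂ) (m b a : ℕ) :
    faceWeight c (m + 1) (b + 1) (a + 1) = faceWeight c m b (a + 1) - faceWeight c m b a := by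
  simp only [faceWeight, Nat.add_sub_add_right, kraw_succ_right]
  push_cast
  ring

lemma faceWeight_zero (c : ℂ) (m b : ℕ) : faceWeight c m b 0 = 1 := by
  simp [faceWeight, kraw_zero, kraw_one]

lemma faceWeight_top (c : ℂ) {m b : ℕ} (hb : b ≤ m) :
    faceWeight c m b (m + 1) = c * (-1) ^ b := by
  have h1 := kraw_eq_zero (m - b) b 0
  have h2 := kraw_top (m - b) b
  rw [Nat.sub_add_cancel hb] at h1 h2
  simp only [add_zero] at h1
  simp [faceWeight, h1, h2]

lemma faceWeight_above (c : ℂ) {m b : ℕ} (hb : b ≤ m) : faceWeight c m b (m + 2) = 0 := by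
  have h1 := kraw_eq_zero (m - b) b 0
  have h2 := kraw_eq_zero (m - b) b 1
  rw [Nat.sub_add_cancel hb] at h1 h2
  simp only [add_zero] at h1
  simp [faceWeight, h1, h2]

/-- The Aztec system written in rotated coordinates inside the diamond. -/
structure RotatedAztec (S : ℕ → ℕ → ℕ → ℂ) : Prop where
  init : S 0 0 0 = 0
  interior : ∀ m a b, a ≤ m → b ≤ m → 2 * (S (a + 1) (b + 1) (m + 2) + S a b m)
    = S (a + 1) (b + 1) (m + 1) + S (a + 1) b (m + 1) + S a b (m + 1) + S a (b + 1) (m + 1)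
  sideSW : ∀ m b, b ≤ m → 2 * S 0 (b + 1) (m + 2) = S 0 b (m + 1) + S 0 (b + 1) (m + 1)
  sideNW : ∀ m a, a ≤ m → 2 * S (a + 1) 0 (m + 2) = S a 0 (m + 1) + S (a + 1) 0 (m + 1)
  sideNE : ∀ m b, b ≤ m →
    2 * S (m + 2) (b + 1) (m + 2) = S (m + 1) b (m + 1) + S (m + 1) (b + 1) (m + 1)
  sideSE : ∀ m a, a ≤ m →
    2 * S (a + 1) (m + 2) (m + 2) = S a (m + 1) (m + 1) + S (a + 1) (m + 1) (m + 1)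
  cornerE : ∀ m, 2 * S (m + 1) (m + 1) (m + 1) = S m m m + 1
  cornerN : ∀ m, 2 * S (m + 1) 0 (m + 1) = S m 0 m + Complex.I
  cornerW : ∀ m, 2 * S 0 0 (m + 1) = S 0 0 m - 1
  cornerS : ∀ m, 2 * S 0 (m + 1) (m + 1) = S 0 m m - Complex.I

lemma halving_sequence {s : ℕ → ℂ} {c : ℂ} (h0 : s 0 = 0) (h : ∀ m, 2 * s (m + 1) = s m + c)
    (m : ℕ) : s (m + 1) = s m + (1 / 2) ^ (m + 1) * c := by
  have closed : ∀ m, s m = c - (1 / 2) ^ m * c := by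
    intro m
    induction m with
    | zero => simp [h0]
    | succ m ih =>
      rw [pow_succ]
      linear_combination (1 / 2) * h m + (1 / 2) * ih
  rw [closed, closed, pow_succ]
  ring

open Complex in
/-- Each edge of the t-embedding is a product of two face weights. -/
theorem RotatedAztec.edges {S : ℕ → ℕ → ℕ → ℂ} (h : RotatedAztec S) (m : ℕ) :
    ∀ a b, a ≤ m → b ≤ m →
      (S (a + 1) (b + 1) (m + 1) = S a b m
        + (1 / 2) ^ (m + 1) * (faceWeight I m b (a + 1) * faceWeight (-I) m a (b + 1))) ∧
      (S (a + 1) b (m + 1) = S a b m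
        + (1 / 2) ^ (m + 1) * (faceWeight I m b (a + 1) * faceWeight (-I) m a b)) ∧
      (S a b (m + 1) = S a b m
        - (1 / 2) ^ (m + 1) * (faceWeight I m b a * faceWeight (-I) m a b)) ∧
      (S a (b + 1) (m + 1) = S a b m
        + (1 / 2) ^ (m + 1) * (faceWeight I m b a * faceWeight (-I) m a (b + 1))) := by
  have cE (m : ℕ) : S (m + 1) (m + 1) (m + 1) = S m m m
      + (1 / 2) ^ (m + 1) * (faceWeight I m m (m + 1) * faceWeight (-I) m m (m + 1)) := by
    rw [faceWeight_top _ le_rfl, faceWeight_top _ le_rfl,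
      show I * (-1) ^ m * (-I * (-1) ^ m) = 1 by
        linear_combination (-(-1) ^ m * (-1) ^ m) * I_mul_I + (by
          rw [← mul_pow]; norm_num : ((-1 : ℂ) ^ m * (-1) ^ m) = 1)]
    exact halving_sequence (s := fun m => S m m m) h.init h.cornerE m
  have cN (m : ℕ) : S (m + 1) 0 (m + 1) = S m 0 m
      + (1 / 2) ^ (m + 1) * (faceWeight I m 0 (m + 1) * faceWeight (-I) m m 0) := by
    rw [faceWeight_top _ m.zero_le, faceWeight_zero, pow_zero, mul_one, mul_one]
    exact halving_sequence (s := fun m => S m 0 m) h.init h.cornerN m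
  have cW (m : ℕ) : S 0 0 (m + 1) = S 0 0 m
      - (1 / 2) ^ (m + 1) * (faceWeight I m 0 0 * faceWeight (-I) m 0 0) := by
    rw [faceWeight_zero, faceWeight_zero]
    have := halving_sequence (s := fun m => S 0 0 m) (c := -1) h.init h.cornerW m
    linear_combination this
  have cS (m : ℕ) : S 0 (m + 1) (m + 1) = S 0 m m
      + (1 / 2) ^ (m + 1) * (faceWeight I m m 0 * faceWeight (-I) m 0 (m + 1)) := by
    rw [faceWeight_top _ m.zero_le, faceWeight_zero, pow_zero, mul_one, one_mul]
    exact halving_sequence (s := fun m => S 0 m m) (c := -I) h.init h.cornerS m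
  induction m with
  | zero =>
    intro a b ha hb
    obtain rfl : a = 0 := by omega
    obtain rfl : b = 0 := by omega
    exact ⟨cE 0, cN 0, cW 0, cS 0⟩
  | succ m ih =>
    have hp : (1 / 2 : ℂ) ^ (m + 1 + 1) = (1 / 2) * (1 / 2) ^ (m + 1) := by rw [pow_succ]; ring
    intro a b ha hb
    refine ⟨?_, ?_, ?_, ?_⟩
    · rcases Nat.lt_or_eq_of_le ha with ha | rfl <;> rcases Nat.lt_or_eq_of_le hb with hb | rfl
      · have ha' : a ≤ m := by omega
        have hb' : b ≤ m := by omega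
        obtain ⟨e1, e2, e3, e4⟩ := ih a b ha' hb'
        have e := h.interior m a b ha' hb'
        rw [faceWeight_succ _ _ ha', faceWeight_succ _ _ hb', hp]
        linear_combination (1 / 2) * e + (1 / 2) * (e1 + e2 + e3 + e4) - e3
      · have ha' : a ≤ m := by omega
        obtain ⟨e1, e2, e3, e4⟩ := ih a m ha' le_rfl
        have e := h.sideSE m a ha'
        rw [faceWeight_succ _ _ ha', faceWeight_succ_succ, faceWeight_above _ ha', hp]
        linear_combination (1 / 2) * e + (1 / 2) * (e1 - e4)
      · have hb' : b ≤ m := by omega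
        obtain ⟨e1, e2, e3, e4⟩ := ih m b le_rfl hb'
        have e := h.sideNE m b hb'
        rw [faceWeight_succ _ _ hb', faceWeight_succ_succ, faceWeight_above _ hb', hp]
        linear_combination (1 / 2) * e + (1 / 2) * (e1 - e2)
      · exact cE (m + 1)
    · rcases Nat.lt_or_eq_of_le ha with ha | rfl <;> rcases b with _ | b
      · have ha' : a ≤ m := by omega
        obtain ⟨e1, e2, e3, e4⟩ := ih a 0 ha' m.zero_le
        have e := h.sideNW m a ha'
        rw [faceWeight_succ _ _ m.zero_le, faceWeight_zero, hp]
        rw [faceWeight_zero] at e2 e3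
        linear_combination (1 / 2) * e + (1 / 2) * (e2 - e3)
      · have ha' : a ≤ m := by omega
        have hb' : b ≤ m := by omega
        obtain ⟨e1, e2, e3, e4⟩ := ih a b ha' hb'
        have e := h.interior m a b ha' hb'
        rw [faceWeight_succ_succ, faceWeight_succ _ _ ha', hp]
        linear_combination (1 / 2) * e + (1 / 2) * (e1 + e2 + e3 + e4) - e4
      · exact cN (m + 1)
      · have hb' : b ≤ m := by omega
        obtain ⟨e1, e2, e3, e4⟩ := ih m b le_rfl hb'
        have e := h.sideNE m b hb'
        rw [faceWeight_succ_succ, faceWeight_succ_succ, faceWeight_above _ hb', hp]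
        linear_combination (1 / 2) * e + (1 / 2) * (e2 - e1)
    · rcases a with _ | a <;> rcases b with _ | b
      · exact cW (m + 1)
      · have hb' : b ≤ m := by omega
        obtain ⟨e1, e2, e3, e4⟩ := ih 0 b m.zero_le hb'
        have e := h.sideSW m b hb'
        rw [faceWeight_succ _ _ m.zero_le, faceWeight_zero, hp]
        rw [faceWeight_zero] at e3 e4
        linear_combination (1 / 2) * e + (1 / 2) * (e3 - e4)
      · have ha' : a ≤ m := by omega
        obtain ⟨e1, e2, e3, e4⟩ := ih a 0 ha' m.zero_le
        have e := h.sideNW m a ha'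
        rw [faceWeight_succ _ _ m.zero_le, faceWeight_zero, hp]
        rw [faceWeight_zero] at e2 e3
        linear_combination (1 / 2) * e + (1 / 2) * (e3 - e2)
      · have ha' : a ≤ m := by omega
        have hb' : b ≤ m := by omega
        obtain ⟨e1, e2, e3, e4⟩ := ih a b ha' hb'
        have e := h.interior m a b ha' hb'
        rw [faceWeight_succ_succ, faceWeight_succ_succ, hp]
        linear_combination (1 / 2) * e + (1 / 2) * (e1 + e2 + e3 + e4) - e1
    · rcases a with _ | a <;> rcases Nat.lt_or_eq_of_le hb with hb | rfl
      · have hb' : b ≤ m := by omega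
        obtain ⟨e1, e2, e3, e4⟩ := ih 0 b m.zero_le hb'
        have e := h.sideSW m b hb'
        rw [faceWeight_zero, faceWeight_succ _ _ m.zero_le, hp]
        rw [faceWeight_zero] at e3 e4
        linear_combination (1 / 2) * e + (1 / 2) * (e4 - e3)
      · exact cS (m + 1)
      · have ha' : a ≤ m := by omega
        have hb' : b ≤ m := by omega
        obtain ⟨e1, e2, e3, e4⟩ := ih a b ha' hb'
        have e := h.interior m a b ha' hb'
        rw [faceWeight_succ _ _ hb', faceWeight_succ_succ, hp]
        linear_combination (1 / 2) * e + (1 / 2) * (e1 + e2 + e3 + e4) - e2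
      · have ha' : a ≤ m := by omega
        obtain ⟨e1, e2, e3, e4⟩ := ih a m ha' le_rfl
        have e := h.sideSE m a ha'
        rw [faceWeight_succ_succ, faceWeight_succ_succ, faceWeight_above _ ha', hp]
        linear_combination (1 / 2) * e + (1 / 2) * (e4 - e1)

lemma SolvesAztec.eq_zero {T : ℤ → ℤ → ℤ → ℂ}
    (hT : SolvesAztec 0 1 Complex.I (-1) (-Complex.I) T) (n : ℕ) :
    ∀ j k : ℤ, (j + k + n) % 2 = 1 → n ≤ j.natAbs + k.natAbs → T j k n = 0 := by
  induction n using Nat.twoStepInduction with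
  | zero => intro j k h _; exact hT.1 j k (by rw [Int.odd_iff]; simpa using h)
  | one =>
    intro j k h hjk
    push_cast at h
    have e := hT.2.2 j k 0 (by rw [Int.even_iff]; omega)
    have h1 := hT.2.1 j k (by rw [Int.even_iff]; omega)
    have z : ∀ j' k' : ℤ, (j' + k') % 2 = 1 → T j' k' 0 = 0 :=
      fun j' k' h' => hT.1 j' k' (Int.odd_iff.2 h')
    rw [z (j - 1) k (by omega), z (j + 1) k (by omega), z j (k + 1) (by omega),
      z j (k - 1) (by omega), zero_add, zero_sub, h1] at e
    have hne : ¬ (j = 0 ∧ k = 0) := by omega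
    simpa [hne] using e
  | more n ih0 ih1 =>
    intro j k h hjk
    push_cast at hjk h
    have e := hT.2.2 j k (n + 1) (by rw [Int.even_iff]; omega)
    have z : ∀ j' k' : ℤ, (j' + k' + (n + 1)) % 2 = 1 → n + 1 ≤ j'.natAbs + k'.natAbs →
        T j' k' (n + 1) = 0 := by
      intro j' k' h1 h2
      exact_mod_cast ih1 j' k' (by exact_mod_cast h1) h2
    rw [z (j - 1) k (by omega) (by omega), z (j + 1) k (by omega) (by omega),
      z j (k + 1) (by omega) (by omega), z j (k - 1) (by omega) (by omega),
      if_neg (by omega), if_neg (by omega), if_neg (by omega), if_neg (by omega),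
      if_neg (by omega), show (n : ℤ) + 1 - 1 = n by ring, ih0 j k (by omega) (by omega),
      show (n : ℤ) + 1 + 1 = n + 2 by ring] at e
    push_cast
    simpa using e

lemma SolvesAztec.rotated {T : ℤ → ℤ → ℤ → ℂ}
    (hT : SolvesAztec 0 1 Complex.I (-1) (-Complex.I) T) :
    RotatedAztec (fun a b m => T ((a : ℤ) + b - m) ((a : ℤ) - b) ((m : ℤ) + 1)) := by
  obtain ⟨S, hS⟩ : ∃ S : ℤ → ℤ → ℤ → ℂ, ∀ a b m, S a b m = T (a + b - m) (a - b) (m + 1) :=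
    ⟨_, fun _ _ _ => rfl⟩
  have van : ∀ a b m : ℤ, -1 ≤ m → (a < 0 ∨ b < 0 ∨ m < a ∨ m < b) → S a b m = 0 := by
    intro a b m hm h
    obtain ⟨n, hn⟩ := Int.eq_ofNat_of_zero_le (show 0 ≤ m + 1 by omega)
    rw [hS, hn]
    exact hT.eq_zero n _ _ (by omega) (by omega)
  have step : ∀ a b m : ℤ, 2 * (S (a + 1) (b + 1) (m + 2) + S a b m)
      = S (a + 1) (b + 1) (m + 1) + S (a + 1) b (m + 1) + S a b (m + 1) + S a (b + 1) (m + 1)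
        + ((if a = m + 1 ∧ b = m + 1 then 1 else 0) + (if a = -1 ∧ b = -1 then -1 else 0)
          + (if a = m + 1 ∧ b = -1 then Complex.I else 0)
          + (if a = -1 ∧ b = m + 1 then -Complex.I else 0)) := by
    intro a b m
    have e := hT.2.2 (a + b - m) (a - b) (m + 2) ⟨a + 1, by ring⟩
    simp only [hS]
    rw [show a + 1 + (b + 1) - (m + 2) = a + b - m by ring,
      show a + 1 - (b + 1) = a - b by ring, show m + 2 + 1 = m + 1 + 2 by ring,
      show a + 1 + (b + 1) - (m + 1) = a + b - m + 1 by ring,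
      show a + 1 + b - (m + 1) = a + b - m by ring,
      show a + 1 - b = a - b + 1 by ring, show a + b - (m + 1) = a + b - m - 1 by ring,
      show a + (b + 1) - (m + 1) = a + b - m by ring,
      show a - (b + 1) = a - b - 1 by ring, show m + 1 + 1 = m + 2 by ring]
    rw [show m + 2 + 1 = m + 1 + 2 by ring, show m + 2 - 1 = m + 1 by ring] at e
    have c1 : (a + b - m = m + 2 ∧ a - b = 0) ↔ (a = m + 1 ∧ b = m + 1) := by omega
    have c2 : (a + b - m = -(m + 2) ∧ a - b = 0) ↔ (a = -1 ∧ b = -1) := by omega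
    have c3 : (a + b - m = 0 ∧ a - b = m + 2) ↔ (a = m + 1 ∧ b = -1) := by omega
    have c4 : (a + b - m = 0 ∧ a - b = -(m + 2)) ↔ (a = -1 ∧ b = m + 1) := by omega
    simp only [c1, c2, c3, c4, ite_self] at e ⊢
    linear_combination 2 * e
  suffices h : RotatedAztec (fun a b m => S a b m) by simpa only [hS] using h
  constructor
  · push_cast
    rw [hS]
    have e := hT.2.2 0 0 0 (by simp)
    rw [zero_sub, hT.2.1 0 0 (by simp), hT.1 (-1) 0 (by decide), hT.1 (0 + 1) 0 (by decide),
      hT.1 0 (0 + 1) (by decide), hT.1 0 (-1) (by decide)] at e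
    simpa using e
  · intro m a b ha hb
    have e := step a b m
    rw [if_neg (by omega), if_neg (by omega), if_neg (by omega), if_neg (by omega)] at e
    push_cast
    linear_combination e
  · intro m b hb
    have e := step (-1) b m
    rw [if_neg (by omega), if_neg (by omega), if_neg (by omega), if_neg (by omega), van (-1) _ _ (by omega) (by omega), van (-1) _ _ (by omega) (by omega),
      van (-1) _ _ (by omega) (by omega), neg_add_cancel] at e
    push_cast
    linear_combination e
  · intro m a ha
    have e := step a (-1) m
    rw [if_neg (by omega), if_neg (by omega), if_neg (by omega), if_neg (by omega), van _ (-1) _ (by omega) (by omega), van _ (-1) _ (by omega) (by omega),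
      van _ (-1) _ (by omega) (by omega), neg_add_cancel] at e
    push_cast
    linear_combination e
  · intro m b hb
    have e := step (m + 1) b m
    rw [if_neg (by omega), if_neg (by omega), if_neg (by omega), if_neg (by omega), van _ b m (by omega) (by omega),
      van (m + 1 + 1) (b + 1) (m + 1) (by omega) (by omega),
      van (m + 1 + 1) b (m + 1) (by omega) (by omega), show (m : ℤ) + 1 + 1 = m + 2 by ring] at e
    push_cast
    linear_combination e
  · intro m a ha
    have e := step a (m + 1) m
    rw [if_neg (by omega), if_neg (by omega), if_neg (by omega), if_neg (by omega), van a _ m (by omega) (by omega),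
      van (a + 1) (m + 1 + 1) (m + 1) (by omega) (by omega),
      van a (m + 1 + 1) (m + 1) (by omega) (by omega), show (m : ℤ) + 1 + 1 = m + 2 by ring] at e
    push_cast
    linear_combination e
  · intro m
    have e := step m m (m - 1)
    rw [if_pos (by omega), if_neg (by omega), if_neg (by omega),
      if_neg (by omega), sub_add_cancel, show (m : ℤ) - 1 + 2 = m + 1 by ring,
      van m m (m - 1) (by omega) (by omega), van (m + 1) (m + 1) m (by omega) (by omega),
      van (m + 1) m m (by omega) (by omega), van m (m + 1) m (by omega) (by omega)] at e
    push_cast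
    linear_combination e
  · intro m
    have e := step m (-1) (m - 1)
    rw [if_neg (by omega), if_neg (by omega), if_pos (by omega),
      if_neg (by omega), sub_add_cancel, neg_add_cancel, show (m : ℤ) - 1 + 2 = m + 1 by ring,
      van m (-1) (m - 1) (by omega) (by omega), van (m + 1) 0 m (by omega) (by omega),
      van (m + 1) (-1) m (by omega) (by omega), van m (-1) m (by omega) (by omega)] at e
    push_cast
    linear_combination e
  · intro m
    have e := step (-1) (-1) (m - 1)
    rw [if_neg (by omega), if_pos (by omega), if_neg (by omega),
      if_neg (by omega), sub_add_cancel, neg_add_cancel, show (m : ℤ) - 1 + 2 = m + 1 by ring,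
      van (-1) (-1) (m - 1) (by omega) (by omega), van 0 (-1) m (by omega) (by omega),
      van (-1) (-1) m (by omega) (by omega), van (-1) 0 m (by omega) (by omega)] at e
    push_cast
    linear_combination e
  · intro m
    have e := step (-1) m (m - 1)
    rw [if_neg (by omega), if_neg (by omega), if_neg (by omega),
      if_pos (by omega), sub_add_cancel, neg_add_cancel, show (m : ℤ) - 1 + 2 = m + 1 by ring,
      van (-1) m (m - 1) (by omega) (by omega), van 0 (m + 1) m (by omega) (by omega),
      van (-1) m m (by omega) (by omega), van (-1) (m + 1) m (by omega) (by omega)] at e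
    push_cast
    linear_combination e

open scoped ComplexConjugate

/-- `v` is obtained from `u` by a left turn, quantitatively bounded away from `0` and `π`. -/
def LeftTurn (δ : ℝ) (u v : ℂ) : Prop :=
  0 < (v * conj u).im ∧ δ * Complex.normSq u ≤ (v * conj u).im ∧
    δ * Complex.normSq v ≤ (v * conj u).im

lemma LeftTurn.neg_swap {δ : ℝ} {u v : ℂ} (h : LeftTurn δ u v) : LeftTurn δ (-v) u := by
  have e : (u * conj (-v)).im = (v * conj u).im := by simp; ring
  exact ⟨e ▸ h.1, by rw [e, Complex.normSq_neg]; exact h.2.2, by rw [e]; exact h.2.1⟩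

lemma LeftTurn.smul {δ : ℝ} {u v : ℂ} (h : LeftTurn δ u v) {c : ℂ} (hc : c ≠ 0) :
    LeftTurn δ (c * u) (c * v) := by
  have e : (c * v * conj (c * u)).im = Complex.normSq c * (v * conj u).im := by
    rw [map_mul, show c * v * (conj c * conj u) = (c * conj c) * (v * conj u) by ring,
      Complex.mul_conj, Complex.im_ofReal_mul]
  have hn : 0 < Complex.normSq c := Complex.normSq_pos.2 hc
  obtain ⟨h1, h2, h3⟩ := h
  refine ⟨?_, ?_, ?_⟩
  · rw [e]; positivity
  · rw [e, map_mul, mul_left_comm]; exact mul_le_mul_of_nonneg_left h2 hn.le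
  · rw [e, map_mul, mul_left_comm]; exact mul_le_mul_of_nonneg_left h3 hn.le

lemma LeftTurn.ne_zero_left {δ : ℝ} {u v : ℂ} (h : LeftTurn δ u v) : u ≠ 0 := by
  rintro rfl
  simpa using h.1

lemma LeftTurn.ne_zero_right {δ : ℝ} {u v : ℂ} (h : LeftTurn δ u v) : v ≠ 0 := by
  rintro rfl
  simpa using h.1

lemma LeftTurn.mono {δ δ' : ℝ} {u v : ℂ} (h : LeftTurn δ u v) (hδ : δ' ≤ δ) :
    LeftTurn δ' u v :=
  ⟨h.1, (mul_le_mul_of_nonneg_right hδ (Complex.normSq_nonneg _)).trans h.2.1,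
    (mul_le_mul_of_nonneg_right hδ (Complex.normSq_nonneg _)).trans h.2.2⟩

lemma LeftTurn.sub_add {δ : ℝ} {u v : ℂ} (hδ : 0 ≤ δ) (h : LeftTurn δ u v) :
    LeftTurn (δ / 2) (u - v) (u + v) := by
  have e : ((u + v) * conj (u - v)).im = 2 * (v * conj u).im := by simp; ring
  obtain ⟨h1, h2, h3⟩ := h
  have hs : Complex.normSq (u + v) + Complex.normSq (u - v)
      = 2 * Complex.normSq u + 2 * Complex.normSq v := by
    simp only [Complex.normSq_apply, Complex.add_re, Complex.add_im, Complex.sub_re,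
      Complex.sub_im]
    ring
  have hp := mul_nonneg hδ (Complex.normSq_nonneg (u + v))
  have hm := mul_nonneg hδ (Complex.normSq_nonneg (u - v))
  have hs' : δ * (Complex.normSq (u + v) + Complex.normSq (u - v))
      = δ * (2 * Complex.normSq u + 2 * Complex.normSq v) := by rw [hs]
  refine ⟨?_, ?_, ?_⟩ <;> rw [e] <;> linarith

lemma LeftTurn.arg_mem {δ : ℝ} {u v : ℂ} (hδ : 0 < δ) (h : LeftTurn δ u v) :
    δ / 2 < Complex.arg (v / u) ∧ Complex.arg (v / u) < Real.pi - δ / 2 := by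
  have hu := h.ne_zero_left
  have hv := h.ne_zero_right
  obtain ⟨h1, h2, h3⟩ := h
  have hnu : 0 < ‖u‖ := norm_pos_iff.2 hu
  have hnv : 0 < ‖v‖ := norm_pos_iff.2 hv
  have key : δ * (‖u‖ * ‖v‖) ≤ (v * conj u).im := by
    rw [Complex.normSq_eq_norm_sq] at h2 h3
    nlinarith [mul_nonneg hδ.le (sq_nonneg (‖u‖ - ‖v‖))]
  have him : (v / u).im = (v * conj u).im / ‖u‖ ^ 2 := by
    rw [div_eq_mul_inv, Complex.inv_def, ← mul_assoc, Complex.im_mul_ofReal,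
      Complex.normSq_eq_norm_sq, div_eq_mul_inv]
  have hpos : 0 < (v / u).im := by rw [him]; positivity
  have hsin : δ ≤ Real.sin (Complex.arg (v / u)) := by
    rw [Complex.sin_arg, him, norm_div, le_div_iff₀ (by positivity), le_div_iff₀ (by positivity)]
    calc δ * (‖v‖ / ‖u‖) * ‖u‖ ^ 2 = δ * (‖u‖ * ‖v‖) := by field_simp
      _ ≤ _ := key
  have h0 : 0 < Complex.arg (v / u) :=
    lt_of_le_of_ne (Complex.arg_nonneg_iff.2 hpos.le) fun h0 => by
      rw [← h0, Real.sin_zero] at hsin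
      linarith
  have hpi : 0 < Real.pi - Complex.arg (v / u) :=
    sub_pos.2 (lt_of_le_of_ne (Complex.arg_le_pi _) fun h0 => by
      rw [h0, Real.sin_pi] at hsin
      linarith)
  have l1 := Real.sin_lt h0
  have l2 := Real.sin_lt hpi
  rw [Real.sin_pi_sub] at l2
  constructor <;> linarith

lemma faceWeight_leftTurn {m a b : ℕ} {κ : ℝ} (ha : a ≤ m) (hb : b ≤ m) (hκ : κ < 1)
    (h : ((m : ℝ) - 2 * b) ^ 2 + (2 * (a : ℝ) - m) ^ 2 ≤ κ * ((m : ℝ) + 2) ^ 2) :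
    LeftTurn ((1 - κ) / 4) (faceWeight Complex.I m b a) (faceWeight Complex.I m b (a + 1)) ∧
    LeftTurn ((1 - κ) / 4) (faceWeight (-Complex.I) m b (a + 1))
      (faceWeight (-Complex.I) m b a) := by
  have hc : ((m - b : ℕ) : ℝ) = m - b := by push_cast [hb]; ring
  obtain ⟨h1, h2, h3⟩ := kraw_turan (u := m - b) (b := b) (s := a) (κ := κ) (by omega) hκ (by
    rw [hc]
    convert h using 2 <;> ring)
  simp only [faceWeight, LeftTurn]
  generalize kraw (m - b) b (a + 1) = x at *
  generalize kraw (m - b) b a = y at *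
  generalize kraw (m - b) b (a + 1 + 1) = z at *
  simp only [Complex.normSq_apply, Complex.mul_im, Complex.mul_re, Complex.add_re, Complex.add_im,
    Complex.ofReal_re, Complex.ofReal_im, Complex.I_re, Complex.I_im, Complex.conj_re,
    Complex.conj_im, Complex.neg_re, Complex.neg_im]
  refine ⟨⟨?_, ?_, ?_⟩, ?_, ?_, ?_⟩ <;> linarith

/-- The four vectors turn left consecutively. -/
def LeftTurns (δ : ℝ) (uE uN uW uS : ℂ) : Prop :=
  LeftTurn δ uE uN ∧ LeftTurn δ uN uW ∧ LeftTurn δ uW uS ∧ LeftTurn δ uS uE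

open Complex in
lemma SolvesAztec.leftTurns {T : ℤ → ℤ → ℤ → ℂ}
    (hT : SolvesAztec 0 1 Complex.I (-1) (-Complex.I) T) {κ : ℝ} (hκ : κ < 1) {j k : ℤ} {m : ℕ}
    (hpar : (j + k + m) % 2 = 0) (h : 2 * ((j : ℝ) ^ 2 + (k : ℝ) ^ 2) ≤ κ * ((m : ℝ) + 2) ^ 2) :
    LeftTurns ((1 - κ) / 8) (T (j + 1) k (m + 2) - T j k (m + 1))
      (T j (k + 1) (m + 2) - T j k (m + 1)) (T (j - 1) k (m + 2) - T j k (m + 1))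
      (T j (k - 1) (m + 2) - T j k (m + 1)) ∧
    LeftTurns ((1 - κ) / 8) (T (j + 1) k (m + 2) - T j k (m + 3))
      (T j (k + 1) (m + 2) - T j k (m + 3)) (T (j - 1) k (m + 2) - T j k (m + 3))
      (T j (k - 1) (m + 2) - T j k (m + 3)) := by
  have hlt : ((j : ℝ) + k) ^ 2 + ((j : ℝ) - k) ^ 2 < ((m : ℝ) + 2) ^ 2 := by
    have : 0 < ((m : ℝ) + 2) ^ 2 := by positivity
    nlinarith
  have hp : |j + k| < (m : ℤ) + 2 := by
    refine abs_lt_of_sq_lt_sq ?_ (by positivity)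
    have : ((j : ℝ) + k) ^ 2 < ((m : ℝ) + 2) ^ 2 := by nlinarith [sq_nonneg ((j : ℝ) - k)]
    exact_mod_cast this
  have hm : |j - k| < (m : ℤ) + 2 := by
    refine abs_lt_of_sq_lt_sq ?_ (by positivity)
    have : ((j : ℝ) - k) ^ 2 < ((m : ℝ) + 2) ^ 2 := by nlinarith [sq_nonneg ((j : ℝ) + k)]
    exact_mod_cast this
  rw [abs_lt] at hp hm
  obtain ⟨a, ha⟩ := Int.eq_ofNat_of_zero_le (show 0 ≤ (m + j + k) / 2 by omega)
  obtain ⟨b, hb⟩ := Int.eq_ofNat_of_zero_le (show 0 ≤ (m + j - k) / 2 by omega)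
  obtain rfl : j = a + b - m := by omega
  obtain rfl : k = a - b := by omega
  have ham : a ≤ m := by omega
  have hbm : b ≤ m := by omega
  obtain ⟨e1, e2, e3, e4⟩ := hT.rotated.edges m a b ham hbm
  have e := hT.rotated.interior m a b ham hbm
  push_cast at e e1 e2 e3 e4 h
  rw [show (a : ℤ) + 1 + (b + 1) - (m + 1) = a + b - m + 1 by ring,
    show (a : ℤ) + 1 - (b + 1) = a - b by ring, show (m : ℤ) + 1 + 1 = m + 2 by ring] at e e1
  rw [show (a : ℤ) + 1 + b - (m + 1) = a + b - m by ring,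
    show (a : ℤ) + 1 - b = a - b + 1 by ring] at e e2
  rw [show (a : ℤ) + b - (m + 1) = a + b - m - 1 by ring] at e e3
  rw [show (a : ℤ) + (b + 1) - (m + 1) = a + b - m by ring,
    show (a : ℤ) - (b + 1) = a - b - 1 by ring] at e e4
  rw [show (a : ℤ) + 1 + (b + 1) - (m + 2) = a + b - m by ring,
    show (m : ℤ) + 2 + 1 = m + 3 by ring] at e
  rw [show (m : ℤ) + 1 + 1 = m + 2 by ring] at e2 e3 e4
  have tA := (faceWeight_leftTurn ham hbm hκ (by linarith)).1
  have tB := (faceWeight_leftTurn hbm ham hκ (by linarith)).2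
  have hc : ((1 / 2 : ℂ) ^ (m + 1)) ≠ 0 := pow_ne_zero _ (by norm_num)
  generalize ((1 / 2 : ℂ) ^ (m + 1)) = c at *
  generalize faceWeight I m b (a + 1) = A' at *
  generalize faceWeight I m b a = A at *
  generalize faceWeight (-I) m a (b + 1) = B' at *
  generalize faceWeight (-I) m a b = B at *
  have hA := tA.ne_zero_left
  have hA' := tA.ne_zero_right
  have hB' := tB.ne_zero_left
  have hB := tB.ne_zero_right
  have hδ : 0 ≤ (1 - κ) / 4 := by linarith
  have sA := tA.sub_add hδ
  have sB := tB.sub_add hδ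
  rw [div_div] at sA sB
  norm_num at sA sB
  have hle : (1 - κ) / 8 ≤ (1 - κ) / 4 := by linarith
  have h1 : (-1 : ℂ) ≠ 0 := by norm_num
  constructor
  · refine ⟨?_, ?_, ?_, ?_⟩
    · convert (tB.mono hle).smul (mul_ne_zero hc hA') using 1
      · linear_combination e1
      · linear_combination e2
    · convert (tA.neg_swap.mono hle).smul (mul_ne_zero (mul_ne_zero h1 hc) hB) using 1
      · linear_combination e2
      · linear_combination e3
    · convert (tB.neg_swap.mono hle).smul (mul_ne_zero hc hA) using 1
      · linear_combination e3
      · linear_combination e4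
    · convert (tA.mono hle).smul (mul_ne_zero hc hB') using 1
      · linear_combination e4
      · linear_combination e1
  · have hc2 : c * (1 / 2) ≠ 0 := mul_ne_zero hc (by norm_num)
    have top : ∀ u v : ℂ, u = T (a + b - m) (a - b) (m + 1) + v →
        u - T (a + b - m) (a - b) (m + 3) = v - c * (1 / 2) * (A' * B' + A' * B - A * B + A * B') := by
      intro u v huv
      linear_combination huv - (1 / 2) * (e + e1 + e2 + e3 + e4)
    rw [top _ _ e1, top _ _ e2, top _ _ (e3.trans (sub_eq_add_neg _ _)), top _ _ e4]
    refine ⟨?_, ?_, ?_, ?_⟩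
    · convert sA.smul (mul_ne_zero (mul_ne_zero h1 hc2) sB.ne_zero_left) using 1 <;> ring
    · convert sB.smul (mul_ne_zero (mul_ne_zero h1 hc2) sA.ne_zero_right) using 1 <;> ring
    · convert sA.neg_swap.smul (mul_ne_zero hc2 sB.ne_zero_right) using 1 <;> ring
    · convert sB.neg_swap.smul (mul_ne_zero (mul_ne_zero h1 hc2) sA.ne_zero_left) using 1 <;> ring

lemma SolvesAztec.leftTurns_text {T : ℤ → ℤ → ℤ → ℂ}
    (hT : SolvesAztec 0 1 Complex.I (-1) (-Complex.I) T) {κ : ℝ} (hκ : κ < 1) {j k n : ℤ}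
    (hn : 2 ≤ n) (h : 2 * ((j : ℝ) ^ 2 + (k : ℝ) ^ 2) ≤ κ * (n : ℝ) ^ 2)
    (h' : 2 * ((j : ℝ) ^ 2 + (k : ℝ) ^ 2) ≤ κ * ((n : ℝ) + 1) ^ 2) :
    LeftTurns ((1 - κ) / 8) (Text T n (j + 1) k - Text T n j k)
      (Text T n j (k + 1) - Text T n j k) (Text T n (j - 1) k - Text T n j k)
      (Text T n j (k - 1) - Text T n j k) := by
  by_cases hpar : (j + k + n) % 2 = 1
  · obtain ⟨m, hm⟩ := Int.eq_ofNat_of_zero_le (show 0 ≤ n - 1 by omega)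
    obtain rfl : n = m + 1 := by omega
    simp only [Text, Int.odd_iff]
    rw [if_pos hpar, if_neg (by omega), if_neg (by omega), if_neg (by omega), if_neg (by omega)]
    have := (hT.leftTurns hκ (j := j) (k := k) (m := m) (by omega) (by
      push_cast at h'
      linarith)).1
    rwa [add_assoc (m : ℤ) 1 1]
  · obtain ⟨m, hm⟩ := Int.eq_ofNat_of_zero_le (show 0 ≤ n - 2 by omega)
    obtain rfl : n = m + 2 := by omega
    simp only [Text, Int.odd_iff]
    rw [if_neg hpar, if_pos (by omega), if_pos (by omega), if_pos (by omega), if_pos (by omega)]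
    have := (hT.leftTurns hκ (j := j) (k := k) (m := m) (by omega) (by
      push_cast at h
      linarith)).2
    rwa [add_assoc (m : ℤ) 2 1]

lemma exists_radius_of_compact_subset_disk {K : Set (ℝ × ℝ)} (hK : IsCompact K)
    (hKD : K ⊆ {p : ℝ × ℝ | p.1 ^ 2 + p.2 ^ 2 < 1 / 2}) :
    ∃ r : ℝ, 0 ≤ r ∧ r < 1 / 2 ∧ ∀ p ∈ K, p.1 ^ 2 + p.2 ^ 2 ≤ r := by
  rcases K.eq_empty_or_nonempty with rfl | hne
  · exact ⟨0, le_rfl, by norm_num, by simp⟩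
  · obtain ⟨p, hp, hmax⟩ := hK.exists_isMaxOn (f := fun p : ℝ × ℝ => p.1 ^ 2 + p.2 ^ 2) hne
      (by fun_prop)
    exact ⟨p.1 ^ 2 + p.2 ^ 2, by positivity, hKD hp, fun q hq => hmax hq⟩

/-- Rigidity of angles: on compact subsets of the open disk of radius `1/√2`,
the angle between two consecutive edges of the perfect t-embedding emanating from a common
vertex is uniformly bounded away from `0` and `π`. -/
theorem aztec_rigidity_angles
    (T : ℤ → ℤ → ℤ → ℂ) (hT : SolvesAztec 0 1 Complex.I (-1) (-Complex.I) T)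
    (K : Set (ℝ × ℝ)) (hK : IsCompact K)
    (hKD : K ⊆ {p : ℝ × ℝ | p.1^2 + p.2^2 < 1/2}) :
    ∃ N : ℤ, ∃ ε : ℝ, 0 < ε ∧ ε < Real.pi / 2 ∧ ∀ n : ℤ, N < n →
      ∀ j k i11 i12 i21 i22 : ℤ,
      ((i11, i12), (i21, i22)) ∈
        ({((1,0),(0,1)), ((0,1),(-1,0)), ((-1,0),(0,-1)), ((0,-1),(1,0))} :
          Set ((ℤ × ℤ) × (ℤ × ℤ))) →
      ((j : ℝ) / ((n : ℝ) + 1), (k : ℝ) / ((n : ℝ) + 1)) ∈ K →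
      (((j + i11 : ℤ) : ℝ) / ((n : ℝ) + 1), ((k + i12 : ℤ) : ℝ) / ((n : ℝ) + 1)) ∈ K →
      (((j + i21 : ℤ) : ℝ) / ((n : ℝ) + 1), ((k + i22 : ℤ) : ℝ) / ((n : ℝ) + 1)) ∈ K →
      ε < Complex.arg ((Text T n (j + i21) (k + i22) - Text T n j k) /
            (Text T n (j + i11) (k + i12) - Text T n j k)) ∧
      Complex.arg ((Text T n (j + i21) (k + i22) - Text T n j k) /
            (Text T n (j + i11) (k + i12) - Text T n j k)) < Real.pi - ε := by
  obtain ⟨r, hr0, hr, hKr⟩ := exists_radius_of_compact_subset_disk hK hKD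
  obtain ⟨κ, hκ⟩ : ∃ κ : ℝ, κ = (1 + 2 * r) / 2 := ⟨_, rfl⟩
  have hκ1 : κ < 1 := by linarith
  have hκ0 : 0 < 1 - κ := by linarith
  have hpi := Real.pi_gt_three
  refine ⟨⌈6 / (1 - 2 * r)⌉ + 1, (1 - κ) / 8 / 2, by linarith, by linarith, ?_⟩
  intro n hn j k i11 i12 i21 i22 hdir hjk _ _
  have hgap : 0 < 1 - 2 * r := by linarith
  have hnr : 6 / (1 - 2 * r) + 1 < n :=
    lt_of_le_of_lt (by gcongr; exact Int.le_ceil _)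
      (by exact_mod_cast hn : ((⌈6 / (1 - 2 * r)⌉ : ℝ) + 1 < n))
  have hn1 : (1 : ℝ) < n := by
    have : 0 < 6 / (1 - 2 * r) := by positivity
    linarith
  have hn6 : 6 ≤ (1 - 2 * r) * n := by
    rw [← div_le_iff₀' hgap]
    linarith
  have hn2 : 2 ≤ n := by
    have : (1 : ℤ) < n := by exact_mod_cast hn1
    omega
  have hrad : (j : ℝ) ^ 2 + (k : ℝ) ^ 2 ≤ r * ((n : ℝ) + 1) ^ 2 := by
    have h := hKr _ hjk
    simp only [div_pow] at h
    rwa [← add_div, div_le_iff₀ (by positivity)] at h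
  have hle : 2 * (r * ((n : ℝ) + 1) ^ 2) ≤ κ * (n : ℝ) ^ 2 := by
    rw [hκ]
    nlinarith
  have hle' : κ * (n : ℝ) ^ 2 ≤ κ * ((n : ℝ) + 1) ^ 2 := by
    have : 0 ≤ κ := by linarith
    gcongr
    linarith
  obtain ⟨t1, t2, t3, t4⟩ :=
    hT.leftTurns_text hκ1 (j := j) (k := k) hn2 (by linarith) (by linarith)
  have hδ : 0 < (1 - κ) / 8 := by linarith
  simp only [Set.mem_insert_iff, Set.mem_singleton_iff, Prod.mk.injEq] at hdir
  rcases hdir with ⟨⟨rfl, rfl⟩, rfl, rfl⟩ | ⟨⟨rfl, rfl⟩, rfl, rfl⟩ | ⟨⟨rfl, rfl⟩, rfl, rfl⟩ |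
    ⟨⟨rfl, rfl⟩, rfl, rfl⟩ <;> simp only [add_zero, ← sub_eq_add_neg]
  · exact t1.arg_mem hδ
  · exact t2.arg_mem hδ
  · exact t3.arg_mem hδ
  · exact t4.arg_mem hδ

end
end

section
/- For all (j,k,n) ∈ ℤ³ with j+k+n odd, n ≥ 1 and |j|+|k| < n, and all radii r₁, r₂ ∈ (0, 1/2), the perfect t-embedding of the reduced Aztec diamond is given by the double contour integral T(j,k,n) = (1/(2πi)²) ∮_{E₂} ∮_{E₁} R(z,w) · G_T(z,w) / (z−w) dz dw − 1. -/
noncomputable section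

/-- The rational function `R(z,w) = wᵃ(z+1)ᵇ(z−1)ᶜ / ((w+1)ᵇ(w−1)ᶜ zᵃ)` with
`a = (n+1+j+k)/2`, `b = (n+1−j+k)/2`, `c = (n+1+j−k)/2`. -/
noncomputable def Rfun (j k n : ℤ) (z w : ℂ) : ℂ :=
  w ^ ((n+1+j+k)/2) * (z+1) ^ ((n+1-j+k)/2) * (z-1) ^ ((n+1+j-k)/2) /
    ((w+1) ^ ((n+1-j+k)/2) * (w-1) ^ ((n+1+j-k)/2) * z ^ ((n+1+j+k)/2))

/-- `G_T(z,w) = (1−i)(z−i)(w−i)/((z−1)(z+1)w)`. -/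
noncomputable def GT (z w : ℂ) : ℂ :=
  (1 - Complex.I) * (z - Complex.I) * (w - Complex.I) / ((z - 1) * (z + 1) * w)

/-- `G_{ι,ι′}` for the four possible directions `(ι,ι′)`. -/
noncomputable def Gdir (i1 i2 : ℤ) (z w : ℂ) : ℂ :=
  if i1 = 1 ∧ i2 = 0 then 1 / (z * (w - 1))
  else if i1 = 0 ∧ i2 = 1 then -(1 / (z * (w + 1)))
  else if i1 = -1 ∧ i2 = 0 then 1 / (w + 1)
  else if i1 = 0 ∧ i2 = -1 then 1 / (w - 1)
  else 0

open Complex Polynomial in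
lemma circleIntegral_inv_pow_mul_inv_sub {c w : ℂ} {R : ℝ} (hR : 0 < R) (hw : R < ‖w - c‖)
    (s : ℕ) : (∮ z in C(c, R), ((z - c) ^ s * (z - w))⁻¹) =
      -(2 * Real.pi * I) * (((w - c) ^ s)⁻¹ - if s = 0 then 1 else 0) := by
  have hzw : ∀ z ∈ Metric.closedBall c R, z - w ≠ 0 := by
    intro z hz h
    rw [sub_eq_zero.1 h, mem_closedBall_iff_norm] at hz
    linarith
  have hzc : ∀ z ∈ Metric.sphere c R, z - c ≠ 0 := by
    intro z hz h
    rw [mem_sphere_iff_norm, h, norm_zero] at hz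
    linarith
  have hwc : w - c ≠ 0 := norm_pos_iff.1 (hR.trans hw)
  induction s with
  | zero =>
    have : DifferentiableOn ℂ (fun z : ℂ => (z - w)⁻¹) (Metric.closedBall c R) :=
      DifferentiableOn.inv (by fun_prop) hzw
    have h := (this.mono Metric.closure_ball_subset_closedBall).diffContOnCl.circleIntegral_eq_zero
      hR.le
    simpa using h
  | succ s ih =>
    have h1 : (∮ z in C(c, R), ((z - c) ^ (s + 1) * (z - w))⁻¹) =
        ∮ z in C(c, R), (w - c)⁻¹ * (((z - c) ^ s * (z - w))⁻¹ - ((z - c) ^ (s + 1))⁻¹) := by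
      refine circleIntegral.integral_congr hR.le fun z hz => ?_
      have := hzc z hz
      have := hzw z (Metric.sphere_subset_closedBall hz)
      field_simp
      ring
    rw [h1, circleIntegral.integral_const_mul, circleIntegral.integral_sub, ih]
    · rcases s with _ | s
      · simp [hR.ne']
        ring
      · have h2 := circleIntegral.integral_sub_zpow_of_ne (n := -((s + 1 + 1 : ℕ) : ℤ))
          (by push_cast; omega) c c R
        simp only [zpow_neg, zpow_natCast] at h2
        rw [h2]
        simp
        field_simp
        ring
    · refine ContinuousOn.circleIntegrable hR.le (ContinuousOn.inv₀ (by fun_prop) fun z hz => ?_)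
      exact mul_ne_zero (pow_ne_zero _ (hzc z hz)) (hzw z (Metric.sphere_subset_closedBall hz))
    · refine ContinuousOn.circleIntegrable hR.le (ContinuousOn.inv₀ (by fun_prop) fun z hz => ?_)
      exact pow_ne_zero _ (hzc z hz)

open Complex Polynomial in
lemma circleIntegral_polynomial_div {c w : ℂ} {R : ℝ} (hR : 0 < R) (hw : R < ‖w - c‖)
    (p : ℂ[X]) (m : ℕ) (hp : p.natDegree ≤ m) :
    (∮ z in C(c, R), p.eval z / ((z - c) ^ m * (z - w))) =
      -(2 * Real.pi * I) * (p.eval w / (w - c) ^ m - p.coeff m) := by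
  set q := taylor c p with hq
  have hqe : ∀ z, p.eval z = ∑ i ∈ Finset.range (m + 1), q.coeff i * (z - c) ^ i := by
    intro z
    rw [← eval_eq_sum_range' (by rw [hq, natDegree_taylor]; omega), hq, taylor_eval,
      sub_add_cancel]
  have hqm : q.coeff m = p.coeff m := by
    rcases hp.eq_or_lt with h | h
    · rw [← h, hq, coeff_taylor_natDegree, leadingCoeff]
    · rw [coeff_eq_zero_of_natDegree_lt h,
        coeff_eq_zero_of_natDegree_lt (by rw [hq, natDegree_taylor]; exact h)]
  have hwc : w - c ≠ 0 := norm_pos_iff.1 (hR.trans hw)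
  have hzw : ∀ z ∈ Metric.sphere c R, z - w ≠ 0 := by
    intro z hz h
    rw [sub_eq_zero.1 h, mem_sphere_iff_norm] at hz
    linarith
  have hzc : ∀ z ∈ Metric.sphere c R, z - c ≠ 0 := by
    intro z hz h
    rw [mem_sphere_iff_norm, h, norm_zero] at hz
    linarith
  have hpow : ∀ x : ℂ, x ≠ 0 → ∀ i ∈ Finset.range (m + 1), x ^ i / x ^ m = (x ^ (m - i))⁻¹ := by
    intro x hx i hi
    rw [pow_sub₀ x hx (by simpa [Nat.lt_succ_iff] using hi), mul_inv, inv_inv, div_eq_mul_inv,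
      mul_comm]
  have h1 : (∮ z in C(c, R), p.eval z / ((z - c) ^ m * (z - w))) =
      ∮ z in C(c, R), ∑ i ∈ Finset.range (m + 1),
        q.coeff i * ((z - c) ^ (m - i) * (z - w))⁻¹ := by
    refine circleIntegral.integral_congr hR.le fun z hz => ?_
    simp only [hqe, Finset.sum_div]
    refine Finset.sum_congr rfl fun i hi => ?_
    rw [mul_inv, ← hpow _ (hzc z hz) i hi]
    field_simp
  rw [h1, circleIntegral.integral_fun_sum]
  · simp only [circleIntegral.integral_const_mul, circleIntegral_inv_pow_mul_inv_sub hR hw]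
    have h2 : p.coeff m = ∑ i ∈ Finset.range (m + 1),
        q.coeff i * (if m - i = 0 then 1 else 0) := by
      rw [Finset.sum_range_succ, Finset.sum_eq_zero, ← hqm]
      · simp
      · intro i hi
        have := Finset.mem_range.1 hi
        rw [if_neg (by omega), mul_zero]
    rw [h2, hqe, Finset.sum_div, ← Finset.sum_sub_distrib, Finset.mul_sum]
    refine Finset.sum_congr rfl fun i hi => ?_
    rw [← hpow _ hwc i hi]
    ring
  · intro i _
    refine ContinuousOn.circleIntegrable hR.le
      (continuousOn_const.mul (ContinuousOn.inv₀ (by fun_prop) fun z hz => ?_))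
    exact mul_ne_zero (pow_ne_zero _ (hzc z hz)) (hzw z hz)

lemma continuous_circleMap_prod {F : ℂ → ℂ → ℂ} {c d : ℂ} {r s : ℝ} (hr : 0 ≤ r) (hs : 0 ≤ s)
    (hF : ContinuousOn (fun p : ℂ × ℂ => F p.1 p.2) (Metric.sphere c r ×ˢ Metric.sphere d s)) :
    Continuous fun p : ℝ × ℝ => F (circleMap c r p.1) (circleMap d s p.2) :=
  hF.comp_continuous (f := fun p : ℝ × ℝ => (circleMap c r p.1, circleMap d s p.2))
    (by fun_prop) fun p => ⟨circleMap_mem_sphere _ hr _, circleMap_mem_sphere _ hs _⟩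

open MeasureTheory in
lemma circleIntegral_circleIntegral_swap {F : ℂ → ℂ → ℂ} {c d : ℂ} {r s : ℝ} (hr : 0 ≤ r)
    (hs : 0 ≤ s)
    (hF : ContinuousOn (fun p : ℂ × ℂ => F p.1 p.2) (Metric.sphere c r ×ˢ Metric.sphere d s)) :
    (∮ w in C(d, s), ∮ z in C(c, r), F z w) = ∮ z in C(c, r), ∮ w in C(d, s), F z w := by
  have hc := continuous_circleMap_prod hr hs hF
  simp only [circleIntegral, deriv_circleMap, smul_eq_mul, ← intervalIntegral.integral_const_mul]
  rw [intervalIntegral_intervalIntegral_swap]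
  · refine intervalIntegral.integral_congr fun x _ => intervalIntegral.integral_congr fun y _ => ?_
    ring
  · have : Continuous (Function.uncurry fun x y : ℝ => circleMap 0 s x * Complex.I *
        (circleMap 0 r y * Complex.I * F (circleMap c r y) (circleMap d s x))) := by
      have h2 : Continuous fun p : ℝ × ℝ => F (circleMap c r p.2) (circleMap d s p.1) :=
        hc.comp continuous_swap
      simp only [Function.uncurry_def]
      exact (((continuous_circleMap 0 s).comp continuous_fst).mul continuous_const).mul
        ((((continuous_circleMap 0 r).comp continuous_snd).mul continuous_const).mul h2)
    exact (this.continuousOn.integrableOn_compact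
      (isCompact_uIcc.prod isCompact_uIcc)).mono_set
        (Set.prod_mono Set.uIoc_subset_uIcc Set.uIoc_subset_uIcc)

lemma circleIntegrable_circleIntegral {F : ℂ → ℂ → ℂ} {c d : ℂ} {r s : ℝ} (hr : 0 ≤ r)
    (hs : 0 ≤ s)
    (hF : ContinuousOn (fun p : ℂ × ℂ => F p.1 p.2) (Metric.sphere c r ×ˢ Metric.sphere d s)) :
    CircleIntegrable (fun w => ∮ z in C(c, r), F z w) d s := by
  have hc := continuous_circleMap_prod hr hs hF
  simp only [CircleIntegrable, circleIntegral, deriv_circleMap, smul_eq_mul]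
  refine Continuous.intervalIntegrable ?_ _ _
  refine intervalIntegral.continuous_parametric_intervalIntegral_of_continuous' ?_ _ _
  have h2 : Continuous fun p : ℝ × ℝ => F (circleMap c r p.2) (circleMap d s p.1) :=
    hc.comp continuous_swap
  simp only [Function.uncurry_def]
  exact (((continuous_circleMap 0 r).comp continuous_snd).mul continuous_const).mul h2

lemma circleIntegrable_left {F : ℂ → ℂ → ℂ} {c d : ℂ} {r s : ℝ} (hr : 0 ≤ r)
    (hF : ContinuousOn (fun p : ℂ × ℂ => F p.1 p.2) (Metric.sphere c r ×ˢ Metric.sphere d s))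
    {w : ℂ} (hw : w ∈ Metric.sphere d s) : CircleIntegrable (fun z => F z w) c r :=
  ContinuousOn.circleIntegrable hr
    (hF.comp (f := fun z : ℂ => (z, w)) (by fun_prop) fun _ hz => ⟨hz, hw⟩)

lemma circleIntegral_circleIntegral_add {F G : ℂ → ℂ → ℂ} {c d : ℂ} {r s : ℝ} (hr : 0 ≤ r)
    (hs : 0 ≤ s)
    (hF : ContinuousOn (fun p : ℂ × ℂ => F p.1 p.2) (Metric.sphere c r ×ˢ Metric.sphere d s))
    (hG : ContinuousOn (fun p : ℂ × ℂ => G p.1 p.2) (Metric.sphere c r ×ˢ Metric.sphere d s)) :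
    (∮ w in C(d, s), ∮ z in C(c, r), (F z w + G z w)) =
      (∮ w in C(d, s), ∮ z in C(c, r), F z w) + ∮ w in C(d, s), ∮ z in C(c, r), G z w := by
  rw [← circleIntegral.integral_add (circleIntegrable_circleIntegral hr hs hF)
    (circleIntegrable_circleIntegral hr hs hG)]
  refine circleIntegral.integral_congr hs fun w hw => ?_
  exact circleIntegral.integral_add (circleIntegrable_left hr hF hw)
    (circleIntegrable_left hr hG hw)

/-- The integrand of the double contour integral in terms of the exponents `a`, `b`, `c`. -/
def aztecKernel (a b c : ℕ) (z w : ℂ) : ℂ :=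
  (1 - Complex.I) * (z - Complex.I) * (w - Complex.I) * w ^ a * (z + 1) ^ b * (z - 1) ^ c /
    ((w + 1) ^ b * (w - 1) ^ c * z ^ a * ((z - 1) * (z + 1) * w * (z - w)))

lemma Rfun_mul_GT_div {a b c : ℕ} {j k n : ℤ} (hj : j = a - b) (hk : k = a - c)
    (hn : n = b + c - 1) (z w : ℂ) :
    Rfun j k n z w * GT z w / (z - w) = aztecKernel a b c z w := by
  have ha : (n + 1 + j + k) / 2 = a := by omega
  have hb : (n + 1 - j + k) / 2 = b := by omega
  have hc : (n + 1 + j - k) / 2 = c := by omega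
  simp only [Rfun, GT, aztecKernel, ha, hb, hc, zpow_natCast]
  rw [div_mul_div_comm, div_div]
  congr 1 <;> ring

lemma ne_on_small_closedBalls {r1 r2 : ℝ} (hr1' : r1 < 1 / 2) (hr2' : r2 < 1 / 2) {z w : ℂ}
    (hz : z ∈ Metric.closedBall (0 : ℂ) r1) (hw : w ∈ Metric.closedBall (1 : ℂ) r2) :
    z - 1 ≠ 0 ∧ z + 1 ≠ 0 ∧ w ≠ 0 ∧ w + 1 ≠ 0 ∧ z - w ≠ 0 := by
  rw [mem_closedBall_iff_norm, sub_zero] at hz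
  rw [mem_closedBall_iff_norm] at hw
  refine ⟨?_, ?_, ?_, ?_, ?_⟩
  · intro h
    rw [sub_eq_zero.1 h] at hz
    norm_num at hz
    linarith
  · intro h
    rw [eq_neg_of_add_eq_zero_left h] at hz
    norm_num at hz
    linarith
  · rintro rfl
    norm_num at hw
    linarith
  · intro h
    rw [eq_neg_of_add_eq_zero_left h] at hw
    norm_num at hw
    linarith
  · intro h
    rw [← sub_eq_zero.1 h] at hw
    have h1 := norm_sub_norm_le 1 z
    rw [norm_sub_rev, norm_one] at h1
    linarith

lemma ne_of_mem_sphere {c z : ℂ} {r : ℝ} (hr : 0 < r) (hz : z ∈ Metric.sphere c r) :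
    z - c ≠ 0 := by
  intro h
  rw [mem_sphere_iff_norm, h, norm_zero] at hz
  linarith

lemma continuousOn_aztecKernel {r1 r2 : ℝ} (hr1 : 0 < r1) (hr1' : r1 < 1 / 2) (hr2 : 0 < r2)
    (hr2' : r2 < 1 / 2) (a b c : ℕ) :
    ContinuousOn (fun p : ℂ × ℂ => aztecKernel a b c p.1 p.2)
      (Metric.sphere 0 r1 ×ˢ Metric.sphere 1 r2) := by
  refine ContinuousOn.div (by fun_prop) (by fun_prop) fun p hp => ?_
  obtain ⟨h1, h2, h3, h4, h5⟩ := ne_on_small_closedBalls hr1' hr2'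
    (Metric.sphere_subset_closedBall hp.1) (Metric.sphere_subset_closedBall hp.2)
  have h6 := ne_of_mem_sphere hr1 hp.1
  have h7 := ne_of_mem_sphere hr2 hp.2
  rw [sub_zero] at h6
  simp [h1, h2, h3, h4, h5, h6, h7]

/-- The normalized double contour integral in terms of the exponents `a`, `b`, `c`. -/
def aztecIntegral (r1 r2 : ℝ) (a b c : ℕ) : ℂ :=
  (1 / (2 * (Real.pi : ℂ) * Complex.I) ^ 2) *
    ∮ w in C(1, r2), ∮ z in C(0, r1), aztecKernel a b c z w

lemma aztecIntegral_eq_swap {r1 r2 : ℝ} (hr1 : 0 < r1) (hr1' : r1 < 1 / 2) (hr2 : 0 < r2)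
    (hr2' : r2 < 1 / 2) (a b c : ℕ) :
    aztecIntegral r1 r2 a b c = (1 / (2 * (Real.pi : ℂ) * Complex.I) ^ 2) *
      ∮ z in C(0, r1), ∮ w in C(1, r2), aztecKernel a b c z w := by
  rw [aztecIntegral, circleIntegral_circleIntegral_swap hr1.le hr2.le
    (continuousOn_aztecKernel hr1 hr1' hr2 hr2' a b c)]

lemma aztecIntegral_zero_left {r1 r2 : ℝ} (hr1 : 0 < r1) (hr1' : r1 < 1 / 2) (hr2 : 0 < r2)
    (hr2' : r2 < 1 / 2) (b c : ℕ) : aztecIntegral r1 r2 0 b c = 0 := by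
  have h : (∮ w in C(1, r2), ∮ z in C(0, r1), aztecKernel 0 b c z w) = ∮ w in C(1, r2), 0 := by
    refine circleIntegral.integral_congr hr2.le fun w hw => ?_
    have hd : DifferentiableOn ℂ (fun z => aztecKernel 0 b c z w) (Metric.closedBall 0 r1) := by
      refine DifferentiableOn.div (by fun_prop) (by fun_prop) fun z hz => ?_
      obtain ⟨h1, h2, h3, h4, h5⟩ := ne_on_small_closedBalls hr1' hr2' hz
        (Metric.sphere_subset_closedBall hw)
      have h7 := ne_of_mem_sphere hr2 hw
      simp [h1, h2, h3, h4, h5, h7]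
    exact (hd.mono Metric.closure_ball_subset_closedBall).diffContOnCl.circleIntegral_eq_zero
      hr1.le
  rw [aztecIntegral, h]
  simp [circleIntegral]

lemma aztecIntegral_zero_right {r1 r2 : ℝ} (hr1 : 0 < r1) (hr1' : r1 < 1 / 2) (hr2 : 0 < r2)
    (hr2' : r2 < 1 / 2) (a b : ℕ) : aztecIntegral r1 r2 a b 0 = 0 := by
  have h : (∮ z in C(0, r1), ∮ w in C(1, r2), aztecKernel a b 0 z w) = ∮ z in C(0, r1), 0 := by
    refine circleIntegral.integral_congr hr1.le fun z hz => ?_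
    have hd : DifferentiableOn ℂ (fun w => aztecKernel a b 0 z w) (Metric.closedBall 1 r2) := by
      refine DifferentiableOn.div (by fun_prop) (by fun_prop) fun w hw => ?_
      obtain ⟨h1, h2, h3, h4, h5⟩ := ne_on_small_closedBalls hr1' hr2'
        (Metric.sphere_subset_closedBall hz) hw
      have h7 := ne_of_mem_sphere hr1 hz
      rw [sub_zero] at h7
      simp [h1, h2, h3, h4, h5, h7]
    exact (hd.mono Metric.closure_ball_subset_closedBall).diffContOnCl.circleIntegral_eq_zero
      hr2.le
  rw [aztecIntegral_eq_swap hr1 hr1' hr2 hr2', h]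
  simp [circleIntegral]

lemma norm_sub_one_gt {r1 r2 : ℝ} (hr1' : r1 < 1 / 2) (hr2' : r2 < 1 / 2) {z : ℂ}
    (hz : z ∈ Metric.sphere (0 : ℂ) r1) : r2 < ‖z - 1‖ := by
  have h1 := norm_sub_norm_le 1 z
  rw [mem_sphere_iff_norm, sub_zero] at hz
  rw [norm_sub_rev, norm_one] at h1
  linarith

lemma norm_sub_zero_gt {r1 r2 : ℝ} (hr1' : r1 < 1 / 2) (hr2' : r2 < 1 / 2) {w : ℂ}
    (hw : w ∈ Metric.sphere (1 : ℂ) r2) : r1 < ‖w - 0‖ := by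
  have h1 := norm_sub_norm_le 1 w
  rw [mem_sphere_iff_norm, norm_sub_rev] at hw
  rw [sub_zero]
  rw [norm_one] at h1
  linarith

open Complex Polynomial in
lemma circleIntegral_aztecKernel_zero_mid {r1 r2 : ℝ} (hr1 : 0 < r1) (hr1' : r1 < 1 / 2)
    (hr2 : 0 < r2) (hr2' : r2 < 1 / 2) {a c : ℕ} (hac : a ≤ c) {z : ℂ}
    (hz : z ∈ Metric.sphere (0 : ℂ) r1) :
    (∮ w in C(1, r2), aztecKernel (a + 1) 0 (c + 1) z w) =
      2 * Real.pi * I * (1 - I) * ((z - 0)⁻¹ * ((z - I) ^ 2 / ((z - 1) * (z + 1))) -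
        (if a = c then 1 else 0) * ((z - I) * (z - 1) ^ c / (z ^ (a + 1) * (z + 1)))) := by
  have hm : (X ^ a * (X - C I) : ℂ[X]).Monic := (monic_X_pow a).mul (monic_X_sub_C I)
  have hdeg : (X ^ a * (X - C I) : ℂ[X]).natDegree = a + 1 := by
    rw [(monic_X_pow a).natDegree_mul (monic_X_sub_C I), natDegree_X_pow, natDegree_X_sub_C]
  have hcoeff : (X ^ a * (X - C I) : ℂ[X]).coeff (c + 1) = if a = c then 1 else 0 := by
    split_ifs with h
    · rw [← h, ← hdeg]
      exact hm
    · exact coeff_eq_zero_of_natDegree_lt (by omega)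
  have key := circleIntegral_polynomial_div hr2 (norm_sub_one_gt hr1' hr2' hz)
    (X ^ a * (X - C I)) (c + 1) (by omega)
  have hz0 := ne_of_mem_sphere hr1 hz
  rw [sub_zero] at hz0
  have h1 : (∮ w in C(1, r2), aztecKernel (a + 1) 0 (c + 1) z w) =
      ∮ w in C(1, r2), -((1 - I) * (z - I) * (z - 1) ^ c / (z ^ (a + 1) * (z + 1))) *
        ((X ^ a * (X - C I) : ℂ[X]).eval w / ((w - 1) ^ (c + 1) * (w - z))) := by
    refine circleIntegral.integral_congr hr2.le fun w hw => ?_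
    obtain ⟨h1, h2, h3, h4, h5⟩ := ne_on_small_closedBalls hr1' hr2'
      (Metric.sphere_subset_closedBall hz) (Metric.sphere_subset_closedBall hw)
    have h6 := ne_of_mem_sphere hr2 hw
    have h7 : w - z ≠ 0 := by rwa [← neg_sub, neg_ne_zero]
    simp only [aztecKernel, eval_mul, eval_pow, eval_X, eval_sub, eval_C]
    rw [← neg_sub w z]
    field_simp
    ring
  obtain ⟨h1', h2, -, -, -⟩ := ne_on_small_closedBalls hr1' hr2'
    (Metric.sphere_subset_closedBall hz)
    (Metric.mem_closedBall_self hr2.le)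
  rw [h1, circleIntegral.integral_const_mul, key, hcoeff]
  simp only [eval_mul, eval_pow, eval_X, eval_sub, eval_C, sub_zero]
  field_simp
  ring

open Complex in
lemma circleIntegral_residue_zero {r1 : ℝ} (hr1 : 0 < r1) (hr1' : r1 < 1 / 2) :
    (∮ z in C(0, r1), (z - 0)⁻¹ * ((z - I) ^ 2 / ((z - 1) * (z + 1)))) = 2 * Real.pi * I := by
  have hd : DifferentiableOn ℂ (fun z : ℂ => (z - I) ^ 2 / ((z - 1) * (z + 1)))
      (Metric.closedBall 0 r1) := by
    refine DifferentiableOn.div (by fun_prop) (by fun_prop) fun z hz => ?_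
    obtain ⟨h1, h2, -, -, -⟩ := ne_on_small_closedBalls hr1' (r2 := 0) (by norm_num) hz
      (Metric.mem_closedBall_self le_rfl)
    exact mul_ne_zero h1 h2
  have := hd.circleIntegral_sub_inv_smul (Metric.mem_ball_self hr1)
  simpa [smul_eq_mul] using this

open Complex in
lemma circleIntegral_residue_one {r2 : ℝ} (hr2 : 0 < r2) (hr2' : r2 < 1 / 2) :
    (∮ w in C(1, r2), (w - 1)⁻¹ * ((w - I) ^ 2 / (w * (w + 1)))) = 2 * Real.pi * I * -I := by
  have hd : DifferentiableOn ℂ (fun w : ℂ => (w - I) ^ 2 / (w * (w + 1)))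
      (Metric.closedBall 1 r2) := by
    refine DifferentiableOn.div (by fun_prop) (by fun_prop) fun w hw => ?_
    obtain ⟨-, -, h3, h4, -⟩ := ne_on_small_closedBalls (r1 := 0) (by norm_num) hr2'
      (Metric.mem_closedBall_self le_rfl) hw
    exact mul_ne_zero h3 h4
  have := hd.circleIntegral_sub_inv_smul (Metric.mem_ball_self hr2)
  simp only [smul_eq_mul] at this
  rw [this, sub_sq, I_sq]
  ring

open Complex in
lemma aztecIntegral_zero_mid_of_lt {r1 r2 : ℝ} (hr1 : 0 < r1) (hr1' : r1 < 1 / 2) (hr2 : 0 < r2)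
    (hr2' : r2 < 1 / 2) {a c : ℕ} (hac : a < c) :
    aztecIntegral r1 r2 (a + 1) 0 (c + 1) = 1 - I := by
  have h : (∮ z in C(0, r1), ∮ w in C(1, r2), aztecKernel (a + 1) 0 (c + 1) z w) =
      ∮ z in C(0, r1), 2 * Real.pi * I * (1 - I) *
        ((z - 0)⁻¹ * ((z - I) ^ 2 / ((z - 1) * (z + 1)))) := by
    refine circleIntegral.integral_congr hr1.le fun z hz => ?_
    simp only [circleIntegral_aztecKernel_zero_mid hr1 hr1' hr2 hr2' hac.le hz, if_neg hac.ne,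
      zero_mul, sub_zero]
  rw [aztecIntegral_eq_swap hr1 hr1' hr2 hr2', h, circleIntegral.integral_const_mul,
    circleIntegral_residue_zero hr1 hr1']
  have := two_pi_I_ne_zero
  field_simp

open Complex Polynomial in
lemma aztecIntegral_zero_mid_self {r1 r2 : ℝ} (hr1 : 0 < r1) (hr1' : r1 < 1 / 2) (hr2 : 0 < r2)
    (hr2' : r2 < 1 / 2) (a : ℕ) : aztecIntegral r1 r2 (a + 1) 0 (a + 1) = 2 ^ (a + 1) := by
  have hsphere : ∀ z ∈ Metric.sphere (0 : ℂ) r1, z ≠ 0 ∧ z - 1 ≠ 0 ∧ z + 1 ≠ 0 := by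
    intro z hz
    obtain ⟨h1, h2, -, -, -⟩ := ne_on_small_closedBalls hr1' (r2 := 0) (by norm_num)
      (Metric.sphere_subset_closedBall hz) (Metric.mem_closedBall_self le_rfl)
    exact ⟨by simpa using ne_of_mem_sphere hr1 hz, h1, h2⟩
  have hm : ((X - C I) * (X - C 1) ^ a : ℂ[X]).Monic :=
    (monic_X_sub_C I).mul ((monic_X_sub_C 1).pow a)
  have hdeg : ((X - C I) * (X - C 1) ^ a : ℂ[X]).natDegree = a + 1 := by
    rw [(monic_X_sub_C I).natDegree_mul ((monic_X_sub_C 1).pow a), natDegree_X_sub_C,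
      natDegree_pow, natDegree_X_sub_C]
    ring
  have hcoeff : ((X - C I) * (X - C 1) ^ a : ℂ[X]).coeff (a + 1) = 1 := by
    rw [← hdeg]
    exact hm
  have key := circleIntegral_polynomial_div (c := 0) (w := -1) hr1 (by norm_num; linarith)
    ((X - C I) * (X - C 1) ^ a) (a + 1) hdeg.le
  simp only [eval_mul, eval_pow, eval_X, eval_sub, eval_C, sub_zero, sub_neg_eq_add, hcoeff]
    at key
  have h : (∮ z in C(0, r1), ∮ w in C(1, r2), aztecKernel (a + 1) 0 (a + 1) z w) =
      ∮ z in C(0, r1), 2 * Real.pi * I * (1 - I) *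
        ((z - 0)⁻¹ * ((z - I) ^ 2 / ((z - 1) * (z + 1))) -
          ((z - I) * (z - 1) ^ a / (z ^ (a + 1) * (z + 1)))) := by
    refine circleIntegral.integral_congr hr1.le fun z hz => ?_
    simp only [circleIntegral_aztecKernel_zero_mid hr1 hr1' hr2 hr2' le_rfl hz, if_true, one_mul]
  rw [aztecIntegral_eq_swap hr1 hr1' hr2 hr2', h, circleIntegral.integral_const_mul,
    circleIntegral.integral_sub, circleIntegral_residue_zero hr1 hr1', key]
  · have h2 : (-1 - 1 : ℂ) ^ a = 2 ^ a * (-1) ^ a := by rw [← mul_pow]; norm_num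
    have h3 : ((-1 : ℂ) ^ a) ≠ 0 := pow_ne_zero _ (by norm_num)
    have := two_pi_I_ne_zero
    have hpi : (Real.pi : ℂ) ≠ 0 := by exact_mod_cast Real.pi_ne_zero
    have hI := I_ne_zero
    rw [h2, pow_succ (-1 : ℂ)]
    field_simp
    ring_nf
    simp only [I_sq]
    ring
  · refine ContinuousOn.circleIntegrable hr1.le ?_
    refine ContinuousOn.mul (ContinuousOn.inv₀ (by fun_prop) fun z hz => ?_)
      (ContinuousOn.div (by fun_prop) (by fun_prop) fun z hz => ?_)
    · simpa using (hsphere z hz).1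
    · simpa using (hsphere z hz).2
  · refine ContinuousOn.circleIntegrable hr1.le
      (ContinuousOn.div (by fun_prop) (by fun_prop) fun z hz => ?_)
    exact mul_ne_zero (pow_ne_zero _ (hsphere z hz).1) (hsphere z hz).2.2

open Complex Polynomial in
lemma aztecIntegral_add {r1 r2 : ℝ} (hr1 : 0 < r1) (hr1' : r1 < 1 / 2) (hr2 : 0 < r2)
    (hr2' : r2 < 1 / 2) (b c : ℕ) :
    aztecIntegral r1 r2 (b + 1 + (c + 1)) (b + 1) (c + 1) = 1 + I := by
  set p : ℂ[X] := (X - C I) * (X + C 1) ^ b * (X - C 1) ^ c with hp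
  have hdeg : p.natDegree = b + c + 1 := by
    rw [hp, (((monic_X_sub_C I).mul ((monic_X_add_C 1).pow b))).natDegree_mul
      ((monic_X_sub_C 1).pow c), (monic_X_sub_C I).natDegree_mul ((monic_X_add_C 1).pow b),
      natDegree_X_sub_C, natDegree_pow, natDegree_X_add_C, natDegree_pow, natDegree_X_sub_C]
    ring
  have h : (∮ w in C(1, r2), ∮ z in C(0, r1),
        aztecKernel (b + 1 + (c + 1)) (b + 1) (c + 1) z w) =
      ∮ w in C(1, r2), -(2 * Real.pi * I * (1 - I)) *
        ((w - 1)⁻¹ * ((w - I) ^ 2 / (w * (w + 1)))) := by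
    refine circleIntegral.integral_congr hr2.le fun w hw => ?_
    have h6 := ne_of_mem_sphere hr2 hw
    have key := circleIntegral_polynomial_div hr1 (norm_sub_zero_gt hr1' hr2' hw) p
      (b + 1 + (c + 1)) (by omega)
    rw [coeff_eq_zero_of_natDegree_lt (by omega), sub_zero] at key
    have h1 : (∮ z in C(0, r1), aztecKernel (b + 1 + (c + 1)) (b + 1) (c + 1) z w) =
        ∮ z in C(0, r1), ((1 - I) * (w - I) * w ^ (b + c + 1) /
          ((w + 1) ^ (b + 1) * (w - 1) ^ (c + 1))) *
            (p.eval z / ((z - 0) ^ (b + 1 + (c + 1)) * (z - w))) := by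
      refine circleIntegral.integral_congr hr1.le fun z hz => ?_
      obtain ⟨h1, h2, h3, h4, h5⟩ := ne_on_small_closedBalls hr1' hr2'
        (Metric.sphere_subset_closedBall hz) (Metric.sphere_subset_closedBall hw)
      have h7 := ne_of_mem_sphere hr1 hz
      rw [sub_zero] at h7
      simp only [aztecKernel, hp, eval_mul, eval_pow, eval_X, eval_sub, eval_add, eval_C, sub_zero]
      field_simp
      ring
    obtain ⟨-, -, h3, h4, -⟩ := ne_on_small_closedBalls hr1' hr2'
      (Metric.mem_closedBall_self hr1.le) (Metric.sphere_subset_closedBall hw)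
    simp only [h1, circleIntegral.integral_const_mul, key]
    simp only [hp, eval_mul, eval_pow, eval_X, eval_sub, eval_add, eval_C, sub_zero]
    field_simp
    ring
  rw [aztecIntegral, h, circleIntegral.integral_const_mul, circleIntegral_residue_one hr2 hr2']
  have hpi : (Real.pi : ℂ) ≠ 0 := by exact_mod_cast Real.pi_ne_zero
  have hI := I_ne_zero
  field_simp
  ring_nf
  simp only [I_sq]
  ring

lemma aztecKernel_recurrence {a b c : ℕ} {z w : ℂ} (hz : z ≠ 0) (hw : w - 1 ≠ 0)
    (hw' : w + 1 ≠ 0) :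
    aztecKernel (a + 1) (b + 1) (c + 1) z w + aztecKernel a b c z w =
      1 / 2 * (aztecKernel (a + 1) b (c + 1) z w + aztecKernel a (b + 1) c z w +
        aztecKernel (a + 1) (b + 1) c z w + aztecKernel a b (c + 1) z w) := by
  have h : ∀ A B C : ℕ, aztecKernel (a + A) (b + B) (c + C) z w =
      aztecKernel a b c z w * ((w / z) ^ A * ((z + 1) / (w + 1)) ^ B * ((z - 1) / (w - 1)) ^ C) := by
    intro A B C
    simp only [aztecKernel, pow_add, div_eq_mul_inv, mul_inv, mul_pow, inv_pow]
    ring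
  have h100 := h 1 1 1
  have h101 := h 1 0 1
  have h010 := h 0 1 0
  have h110 := h 1 1 0
  have h001 := h 0 0 1
  simp only [add_zero] at h100 h101 h010 h110 h001
  rw [h100, h101, h010, h110, h001]
  field_simp
  ring

lemma aztecIntegral_recurrence {r1 r2 : ℝ} (hr1 : 0 < r1) (hr1' : r1 < 1 / 2) (hr2 : 0 < r2)
    (hr2' : r2 < 1 / 2) (a b c : ℕ) :
    aztecIntegral r1 r2 (a + 1) (b + 1) (c + 1) + aztecIntegral r1 r2 a b c =
      1 / 2 * (aztecIntegral r1 r2 (a + 1) b (c + 1) + aztecIntegral r1 r2 a (b + 1) c +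
        aztecIntegral r1 r2 (a + 1) (b + 1) c + aztecIntegral r1 r2 a b (c + 1)) := by
  have hK := continuousOn_aztecKernel hr1 hr1' hr2 hr2'
  have h : (∮ w in C(1, r2), ∮ z in C(0, r1),
        (aztecKernel (a + 1) (b + 1) (c + 1) z w + aztecKernel a b c z w)) =
      ∮ w in C(1, r2), ∮ z in C(0, r1), 1 / 2 *
        (aztecKernel (a + 1) b (c + 1) z w + aztecKernel a (b + 1) c z w +
          aztecKernel (a + 1) (b + 1) c z w + aztecKernel a b (c + 1) z w) := by
    refine circleIntegral.integral_congr hr2.le fun w hw =>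
      circleIntegral.integral_congr hr1.le fun z hz => ?_
    obtain ⟨-, -, -, h4, -⟩ := ne_on_small_closedBalls hr1' hr2'
      (Metric.sphere_subset_closedBall hz) (Metric.sphere_subset_closedBall hw)
    exact aztecKernel_recurrence (by simpa using ne_of_mem_sphere hr1 hz)
      (ne_of_mem_sphere hr2 hw) h4
  simp only [circleIntegral.integral_const_mul] at h
  rw [circleIntegral_circleIntegral_add hr1.le hr2.le (hK _ _ _) (hK _ _ _),
    circleIntegral_circleIntegral_add hr1.le hr2.le
      (((hK _ _ _).add (hK _ _ _)).add (hK _ _ _)) (hK _ _ _),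
    circleIntegral_circleIntegral_add hr1.le hr2.le ((hK _ _ _).add (hK _ _ _)) (hK _ _ _),
    circleIntegral_circleIntegral_add hr1.le hr2.le (hK _ _ _) (hK _ _ _)] at h
  simp only [aztecIntegral]
  linear_combination (1 / (2 * (Real.pi : ℂ) * Complex.I) ^ 2) * h

lemma SolvesAztec.eq_zero_of_le {b0 bE bN bW bS : ℂ} {f : ℤ → ℤ → ℤ → ℂ}
    (hf : SolvesAztec b0 bE bN bW bS f) (n : ℕ) :
    ∀ j k : ℤ, Odd (j + k + n) →
      (n ≤ j + k ∨ n ≤ j - k ∨ n ≤ -j + k ∨ n ≤ -j - k) → f j k n = 0 := by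
  obtain ⟨h0, h1, hrec⟩ := hf
  induction n using Nat.strong_induction_on with
  | _ n ih =>
    rcases n with _ | n
    · intro j k hodd _
      exact h0 j k (by simpa using hodd)
    · intro j k hodd hjk
      push_cast at hodd hjk ⊢
      have hprev : f j k (n - 1 : ℤ) = 0 := by
        rcases n with _ | n
        · refine h1 j k ?_
          push_cast at hodd
          rw [Int.odd_iff] at hodd
          rw [Int.even_iff]
          omega
        · have := ih n (by omega) j k
            (by push_cast at hodd; rw [Int.odd_iff] at hodd ⊢; omega)
            (by push_cast at hjk; omega)
          simpa using this
      have e1 := ih n (by omega) (j - 1) k (by rw [Int.odd_iff] at hodd ⊢; omega) (by omega)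
      have e2 := ih n (by omega) (j + 1) k (by rw [Int.odd_iff] at hodd ⊢; omega) (by omega)
      have e3 := ih n (by omega) j (k + 1) (by rw [Int.odd_iff] at hodd ⊢; omega) (by omega)
      have e4 := ih n (by omega) j (k - 1) (by rw [Int.odd_iff] at hodd ⊢; omega) (by omega)
      have h := hrec j k n (by rw [Int.odd_iff] at hodd; rw [Int.even_iff]; omega)
      rw [hprev, e1, e2, e3, e4, if_neg (by omega), if_neg (by omega), if_neg (by omega),
        if_neg (by omega), if_neg (by omega)] at h
      simpa using h

/-- The value of `aztecIntegral` minus the t-embedding (extended by zero), which is constant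
in the interior `0 < a < b + c`, `0 < b`, `0 < c`. -/
def aztecShift (a b c : ℕ) : ℂ :=
  if a = 0 ∨ c = 0 then 0
  else if b = 0 then (if a = c then 2 ^ a else 1 - Complex.I)
  else if a = b + c then 1 + Complex.I
  else 1

lemma aztecIntegral_eq_aztecShift {r1 r2 : ℝ} (hr1 : 0 < r1) (hr1' : r1 < 1 / 2) (hr2 : 0 < r2)
    (hr2' : r2 < 1 / 2) {a b c : ℕ} (habc : a ≤ b + c)
    (h : a = 0 ∨ b = 0 ∨ c = 0 ∨ a = b + c) :
    aztecIntegral r1 r2 a b c = aztecShift a b c := by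
  rcases a with _ | a
  · simp [aztecIntegral_zero_left hr1 hr1' hr2 hr2', aztecShift]
  rcases c with _ | c
  · simp [aztecIntegral_zero_right hr1 hr1' hr2 hr2', aztecShift]
  rcases b with _ | b
  · rcases (show a ≤ c by omega).eq_or_lt with rfl | hlt
    · simp [aztecIntegral_zero_mid_self hr1 hr1' hr2 hr2', aztecShift]
    · simp [aztecIntegral_zero_mid_of_lt hr1 hr1' hr2 hr2' hlt, aztecShift, hlt.ne]
  · obtain h : a + 1 = b + 1 + (c + 1) := by omega
    rw [h, aztecIntegral_add hr1 hr1' hr2 hr2', aztecShift, if_neg (by omega), if_neg (by omega),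
      if_pos rfl]

lemma aztecShift_recurrence {a b c : ℕ} (habc : a ≤ b + c) :
    aztecShift (a + 1) (b + 1) (c + 1) + aztecShift a b c =
      1 / 2 * (aztecShift (a + 1) b (c + 1) + aztecShift a (b + 1) c +
        aztecShift (a + 1) (b + 1) c + aztecShift a b (c + 1)) -
      1 / 2 * ((if b = 0 ∧ a = b + c then 1 else 0) + (if a = 0 ∧ c = 0 then -1 else 0) +
        (if c = 0 ∧ a = b + c then Complex.I else 0) +
        (if a = 0 ∧ b = 0 then -Complex.I else 0)) := by
  rcases a with _ | a <;> rcases b with _ | b <;> rcases c with _ | c <;>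
    simp [aztecShift] at habc ⊢
  all_goals first | ring1 | (split_ifs <;> first | omega | ring1)

/-- The t-embedding, reindexed by the exponents of the contour integral, differs from the
integral by `aztecShift`. -/
lemma SolvesAztec.aztecIntegral_eq_add {T : ℤ → ℤ → ℤ → ℂ}
    (hT : SolvesAztec 0 1 Complex.I (-1) (-Complex.I) T) {r1 r2 : ℝ} (hr1 : 0 < r1)
    (hr1' : r1 < 1 / 2) (hr2 : 0 < r2) (hr2' : r2 < 1 / 2) (N : ℕ) :
    ∀ a b c : ℕ, b + c = N → a ≤ b + c →
      aztecIntegral r1 r2 a b c = T (a - b) (a - c) (b + c - 1) + aztecShift a b c := by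
  induction N using Nat.strong_induction_on with
  | _ N ih =>
    intro a b c hN habc
    by_cases hbd : a = 0 ∨ b = 0 ∨ c = 0 ∨ a = b + c
    · rw [aztecIntegral_eq_aztecShift hr1 hr1' hr2 hr2' habc hbd, right_eq_add]
      rcases Nat.eq_zero_or_pos N with rfl | hpos
      · obtain ⟨rfl, rfl, rfl⟩ : a = 0 ∧ b = 0 ∧ c = 0 := by omega
        simpa using hT.2.1 0 0 (by simp)
      · have h := hT.eq_zero_of_le (b + c - 1) (a - b) (a - c)
          (by rw [Int.odd_iff]; omega) (by omega)
        rwa [show ((b + c - 1 : ℕ) : ℤ) = b + c - 1 by omega] at h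
    · obtain ⟨a, rfl⟩ := Nat.exists_eq_succ_of_ne_zero (show a ≠ 0 by omega)
      obtain ⟨b, rfl⟩ := Nat.exists_eq_succ_of_ne_zero (show b ≠ 0 by omega)
      obtain ⟨c, rfl⟩ := Nat.exists_eq_succ_of_ne_zero (show c ≠ 0 by omega)
      simp only [Nat.succ_eq_add_one] at *
      have e0 := ih (b + c) (by omega) a b c rfl (by omega)
      have e1 := ih (b + c + 1) (by omega) (a + 1) b (c + 1) (by omega) (by omega)
      have e2 := ih (b + c + 1) (by omega) a (b + 1) c (by omega) (by omega)
      have e3 := ih (b + c + 1) (by omega) (a + 1) (b + 1) c (by omega) (by omega)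
      have e4 := ih (b + c + 1) (by omega) a b (c + 1) (by omega) (by omega)
      have hI := aztecIntegral_recurrence hr1 hr1' hr2 hr2' a b c
      have hS := aztecShift_recurrence (show a ≤ b + c by omega)
      have h := hT.2.2 (a - b) (a - c) (b + c) (by rw [Int.even_iff]; omega)
      have cE : ((a - b : ℤ) = b + c ∧ (a - c : ℤ) = 0) ↔ (b = 0 ∧ a = b + c) := by omega
      have cW : ((a - b : ℤ) = -(b + c) ∧ (a - c : ℤ) = 0) ↔ (a = 0 ∧ c = 0) := by omega
      have cN : ((a - b : ℤ) = 0 ∧ (a - c : ℤ) = b + c) ↔ (c = 0 ∧ a = b + c) := by omega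
      have cS : ((a - b : ℤ) = 0 ∧ (a - c : ℤ) = -(b + c)) ↔ (a = 0 ∧ b = 0) := by omega
      simp only [cE, cW, cN, cS, ite_self, zero_add] at h
      have t1 : T ((a + 1 : ℕ) - b) ((a + 1 : ℕ) - (c + 1 : ℕ)) (b + (c + 1 : ℕ) - 1) =
          T (a - b + 1) (a - c) (b + c) := by congr 1 <;> push_cast <;> ring
      have t2 : T (a - (b + 1 : ℕ)) (a - c) ((b + 1 : ℕ) + c - 1) =
          T (a - b - 1) (a - c) (b + c) := by congr 1 <;> push_cast <;> ring
      have t3 : T ((a + 1 : ℕ) - (b + 1 : ℕ)) ((a + 1 : ℕ) - c) ((b + 1 : ℕ) + c - 1) =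
          T (a - b) (a - c + 1) (b + c) := by congr 1 <;> push_cast <;> ring
      have t4 : T (a - b) (a - (c + 1 : ℕ)) (b + (c + 1 : ℕ) - 1) =
          T (a - b) (a - c - 1) (b + c) := by congr 1 <;> push_cast <;> ring
      have t5 : T ((a + 1 : ℕ) - (b + 1 : ℕ)) ((a + 1 : ℕ) - (c + 1 : ℕ))
          ((b + 1 : ℕ) + (c + 1 : ℕ) - 1) =
          T (a - b) (a - c) (b + c + 1) := by congr 1 <;> push_cast <;> ring
      rw [t1] at e1
      rw [t2] at e2
      rw [t3] at e3
      rw [t4] at e4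
      rw [t5]
      linear_combination hI - hS - h - e0 + 1 / 2 * (e1 + e2 + e3 + e4)

/-- Double contour integral formula for the perfect t-embedding of the
uniformly weighted Aztec diamond. -/
theorem aztec_tembedding_double_contour_integral
    (T : ℤ → ℤ → ℤ → ℂ) (hT : SolvesAztec 0 1 Complex.I (-1) (-Complex.I) T)
    (j k n : ℤ) (hodd : Odd (j + k + n)) (hn : 1 ≤ n) (hjk : |j| + |k| < n)
    (r1 r2 : ℝ) (hr1 : 0 < r1) (hr1' : r1 < 1/2) (hr2 : 0 < r2) (hr2' : r2 < 1/2) :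
    T j k n = (1 / (2 * (Real.pi : ℂ) * Complex.I)^2) *
        (∮ w in C(1, r2), ∮ z in C(0, r1), Rfun j k n z w * GT z w / (z - w)) - 1 := by
  have hmod := hodd
  rw [Int.odd_iff] at hmod
  have h1 := abs_lt.1 (lt_of_le_of_lt (abs_add_le j k) hjk)
  have h2 := abs_lt.1 (lt_of_le_of_lt (abs_sub j k) hjk)
  obtain ⟨a, ha⟩ := Int.eq_ofNat_of_zero_le (show 0 ≤ (n + 1 + j + k) / 2 by omega)
  obtain ⟨b, hb⟩ := Int.eq_ofNat_of_zero_le (show 0 ≤ (n + 1 - j + k) / 2 by omega)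
  obtain ⟨c, hc⟩ := Int.eq_ofNat_of_zero_le (show 0 ≤ (n + 1 + j - k) / 2 by omega)
  have hj : j = a - b := by omega
  have hk : k = a - c := by omega
  have hn' : n = b + c - 1 := by omega
  have key := hT.aztecIntegral_eq_add hr1 hr1' hr2 hr2' (b + c) a b c rfl (by omega)
  rw [← hj, ← hk, ← hn', aztecShift, if_neg (by omega), if_neg (by omega), if_neg (by omega),
    aztecIntegral] at key
  simp only [Rfun_mul_GT_div hj hk hn', key, add_sub_cancel_right]

end
end

section
/- For every data (b_E, b_N, b_W, b_S) ∈ ℂ⁴ there exists exactly one function f̃ : Λ̃ → ℂ solving the tower system with this data. -/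
noncomputable section

/-- A function `f̃ : ℤ³ → ℂ` solves the tower system with data `(bE, bN, bW, bS)`.
Only the values on `Λ̃ = {(j,k,m) : m - j - k ≡ 1 (mod 3)}` are relevant/constrained. -/
def SolvesTower (bE bN bW bS : ℂ) (f : ℤ → ℤ → ℤ → ℂ) : Prop :=
  (∀ j k m : ℤ, (m - j - k) % 3 = 1 → (m = -1 ∨ m = 0 ∨ m = 1) → f j k m = 0) ∧
  (∀ j k m : ℤ, (m + 1 - j - k) % 3 = 1 →
    f j k (m + 1) + f j k (m - 2)
      - (1/2) * (f (j+1) k (m-1) + f j (k+1) (m-1) + f (j-1) k m + f j (k-1) m)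
    = (1/2) * ((if j = m ∧ k = 0 then bE else 0)
             + (if Even m ∧ 2*j = -m ∧ k = 0 then bW else 0)
             + (if j = 0 ∧ k = m then bN else 0)
             + (if Even m ∧ j = 0 ∧ 2*k = -m then bS else 0)))

/-- The right-hand side of the tower system at `(j, k, m)`. -/
def towerSource (bE bN bW bS : ℂ) (j k m : ℤ) : ℂ :=
  (1/2) * ((if j = m ∧ k = 0 then bE else 0)
         + (if Even m ∧ 2*j = -m ∧ k = 0 then bW else 0)
         + (if j = 0 ∧ k = m then bN else 0)
         + (if Even m ∧ j = 0 ∧ 2*k = -m then bS else 0))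

/-- The solution, level by level: the levels `-1, 0, 1` vanish, and the recursion is solved for
its highest level above them and for its lowest level below them. -/
def towerSolution (R : ℤ → ℤ → ℤ → ℂ) (m : ℤ) : ℤ → ℤ → ℂ :=
  if 1 < m then fun j k =>
    R j k (m-1) - towerSolution R (m-3) j k
      + (1/2) * (towerSolution R (m-2) (j+1) k + towerSolution R (m-2) j (k+1)
        + towerSolution R (m-1) (j-1) k + towerSolution R (m-1) j (k-1))
  else if m < -1 then fun j k =>
    R j k (m+2) - towerSolution R (m+3) j k
      + (1/2) * (towerSolution R (m+1) (j+1) k + towerSolution R (m+1) j (k+1)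
        + towerSolution R (m+2) (j-1) k + towerSolution R (m+2) j (k-1))
  else 0
termination_by m.natAbs
decreasing_by all_goals omega

lemma towerSolution_eq_zero (R : ℤ → ℤ → ℤ → ℂ) {m : ℤ} (hm : m = -1 ∨ m = 0 ∨ m = 1)
    (j k : ℤ) : towerSolution R m j k = 0 := by
  rw [towerSolution, if_neg (by omega), if_neg (by omega)]
  rfl

lemma towerSolution_recursion (R : ℤ → ℤ → ℤ → ℂ) (j k m : ℤ) :
    towerSolution R (m+1) j k + towerSolution R (m-2) j k
      - (1/2) * (towerSolution R (m-1) (j+1) k + towerSolution R (m-1) j (k+1)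
        + towerSolution R m (j-1) k + towerSolution R m j (k-1)) = R j k m := by
  rcases lt_or_ge 0 m with h | h
  · rw [towerSolution.eq_def R (m+1), if_pos (by omega), show m + 1 - 1 = m by ring,
      show m + 1 - 2 = m - 1 by ring, show m + 1 - 3 = m - 2 by ring]
    ring
  · rw [towerSolution.eq_def R (m-2), if_neg (by omega), if_pos (by omega),
      show m - 2 + 1 = m - 1 by ring, show m - 2 + 2 = m by ring, show m - 2 + 3 = m + 1 by ring]
    ring

/-- Two solutions agree on every level of `Λ̃`, by induction on the distance to level `0`. -/
lemma SolvesTower.unique {bE bN bW bS : ℂ} {f g : ℤ → ℤ → ℤ → ℂ}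
    (hf : SolvesTower bE bN bW bS f) (hg : SolvesTower bE bN bW bS g) (j k m : ℤ)
    (h : (m - j - k) % 3 = 1) : f j k m = g j k m := by
  induction hn : m.natAbs using Nat.strong_induction_on generalizing j k m with
  | _ n ih =>
    have agree : ∀ j' k' m' : ℤ, m'.natAbs < m.natAbs → (m' - j' - k') % 3 = 1 →
        f j' k' m' = g j' k' m' := fun j' k' m' hlt h' => ih _ (hn ▸ hlt) j' k' m' h' rfl
    rcases lt_or_ge 1 m with hm | hm
    · have ef := hf.2 j k (m-1) (by omega)
      have eg := hg.2 j k (m-1) (by omega)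
      rw [← eg, agree j k (m-1-2) (by omega) (by omega),
        agree (j+1) k (m-1-1) (by omega) (by omega), agree j (k+1) (m-1-1) (by omega) (by omega),
        agree (j-1) k (m-1) (by omega) (by omega), agree j (k-1) (m-1) (by omega) (by omega),
        sub_add_cancel] at ef
      linear_combination ef
    rcases lt_or_ge m (-1) with hm' | hm'
    · have ef := hf.2 j k (m+2) (by omega)
      have eg := hg.2 j k (m+2) (by omega)
      rw [← eg, agree j k (m+2+1) (by omega) (by omega),
        agree (j+1) k (m+2-1) (by omega) (by omega), agree j (k+1) (m+2-1) (by omega) (by omega),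
        agree (j-1) k (m+2) (by omega) (by omega), agree j (k-1) (m+2) (by omega) (by omega),
        add_sub_cancel_right] at ef
      linear_combination ef
    · rw [hf.1 j k m h (by omega), hg.1 j k m h (by omega)]

/-- For every data `(b_E, b_N, b_W, b_S) ∈ ℂ⁴` the tower system has a
solution, and any two solutions agree on `Λ̃ = {(j,k,m) : m−j−k ≡ 1 (mod 3)}` (i.e. there is
exactly one function `Λ̃ → ℂ` solving the system). -/
theorem tower_system_exists_unique (bE bN bW bS : ℂ) :
    (∃ f : ℤ → ℤ → ℤ → ℂ, SolvesTower bE bN bW bS f) ∧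
    (∀ f g : ℤ → ℤ → ℤ → ℂ, SolvesTower bE bN bW bS f → SolvesTower bE bN bW bS g →
      ∀ j k m : ℤ, (m - j - k) % 3 = 1 → f j k m = g j k m) := by
  refine ⟨⟨fun j k m => towerSolution (towerSource bE bN bW bS) m j k, ?_, ?_⟩,
    fun f g hf hg => hf.unique hg⟩
  · exact fun j k m _ hm => towerSolution_eq_zero _ hm j k
  · exact fun j k m _ => towerSolution_recursion _ j k m

end
end

section
/- Let (x,y) ∈ ℝ² satisfy x+y > −1 and 18x²+18y² < (4+x+y)². Set x′ := 3x/(4+x+y) and y′ := 3y/(4+x+y); then 2x′²+2y′² < 1 and, as an identity of complex numbers, (x′ + y′ − i√(1−2x′²−2y′²))/(−1 + x′ − y′) = (−3x − 3y + i√((4+x+y)² − 18x² − 18y²))/(4 + 4y − 2x). In other words, the complex coordinate ξ_aztec inducing the conformal structure of the Gaussian free field on the Aztec diamond, evaluated at the point (3x/(4+x+y), 3y/(4+x+y)), equals the complex coordinate ξ_tower inducing the conformal structure on the tower graph, evaluated at (x,y). -/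
noncomputable section

/-- The change of coordinates `(x,y) ↦ (3x/(4+x+y), 3y/(4+x+y))` maps the
liquid region of the tower graph into the liquid region of the Aztec diamond and transforms
the complex coordinate `ξ_aztec` into `ξ_tower`. -/
theorem aztec_tower_conformal_structure_identity (x y : ℝ)
    (h1 : -1 < x + y) (h2 : 18*x^2 + 18*y^2 < (4 + x + y)^2) :
    2 * (3*x/(4 + x + y))^2 + 2 * (3*y/(4 + x + y))^2 < 1 ∧
    (((3*x/(4 + x + y) + 3*y/(4 + x + y) : ℝ) : ℂ)
        - Complex.I *
          ((Real.sqrt (1 - 2*(3*x/(4 + x + y))^2 - 2*(3*y/(4 + x + y))^2) : ℝ) : ℂ))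
      / (((-1 + 3*x/(4 + x + y) - 3*y/(4 + x + y) : ℝ) : ℂ))
    = (((-3*x - 3*y : ℝ) : ℂ)
        + Complex.I * ((Real.sqrt ((4 + x + y)^2 - 18*x^2 - 18*y^2) : ℝ) : ℂ))
      / (((4 + 4*y - 2*x : ℝ) : ℂ)) := by
  have hs : 0 < 4 + x + y := by linarith
  set s := 4 + x + y with hs_def
  have hs0 : s ≠ 0 := hs.ne'
  have hrad : 1 - 2*(3*x/s)^2 - 2*(3*y/s)^2 = (s^2 - 18*x^2 - 18*y^2) / s^2 := by
    field_simp
    ring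
  have hsqrt : Real.sqrt (1 - 2*(3*x/s)^2 - 2*(3*y/s)^2)
      = Real.sqrt (s^2 - 18*x^2 - 18*y^2) / s := by
    rw [hrad, Real.sqrt_div' _ (sq_nonneg s), Real.sqrt_sq hs.le]
  refine ⟨?_, ?_⟩
  · have hpos : 0 < (s^2 - 18*x^2 - 18*y^2) / s^2 := div_pos (by linarith) (by positivity)
    linarith
  · have hden : -1 + 3*x/s - 3*y/s = -(4 + 4*y - 2*x) / s := by
      field_simp
      rw [hs_def]
      ring
    have hsum : 3*x/s + 3*y/s = -(-3*x - 3*y) / s := by ring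
    have hsC : (-(s : ℂ)) ≠ 0 := neg_ne_zero.mpr (Complex.ofReal_ne_zero.mpr hs0)
    rw [hsqrt, hden, hsum]
    refine Eq.trans ?_ (div_div_div_cancel_right₀ hsC _ _)
    congr 1 <;> push_cast <;> ring

end
end
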